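/- Let f, g ∈ ℝ[x,y] form a pair with nowhere vanishing Jacobian determinant, where f = x⁵ + (terms of total degree ≤ 4). Then the map (f,g): ℝ² → ℝ² is injective. -/

import Mathlib

open MvPolynomial

noncomputable def Jac (f g : MvPolynomial (Fin 2) ℝ) : MvPolynomial (Fin 2) ℝ :=
  pderiv 0 f * pderiv 1 g - pderiv 1 f * pderiv 0 g

open Set Filter Topology in
theorem IsLocalHomeomorph.exists_mem_fst_eq_snd_lt {F : ℝ × ℝ → ℝ × ℝ} (hF : IsLocalHomeomorph F)
    {p : ℝ × ℝ} {U : Set (ℝ × ℝ)} (hU : U ∈ 𝓝 p) :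
    ∃ ε > 0, ∀ s, |s - (F p).2| < ε → ∃ q ∈ U, (F q).1 = (F p).1 ∧ (F q).2 = s := by
  have h1 : F '' U ∈ 𝓝 (F p) := hF.isOpenMap.image_mem_nhds hU
  obtain ⟨ε, hε, hb⟩ := Metric.mem_nhds_iff.1 h1
  refine ⟨ε, hε, fun s hs => ?_⟩
  have : ((F p).1, s) ∈ Metric.ball (F p) ε := by
    rw [Metric.mem_ball, Prod.dist_eq]
    simp [Real.dist_eq, hs]
  obtain ⟨q, hq, hqe⟩ := hb this
  exact ⟨q, hq, by simp [hqe], by simp [hqe]⟩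

open Set Filter Topology in
/-- If the graph of `X` lies in a level set of the first component of a local homeomorphism of the
plane, then the second component is strictly monotone along that graph. -/
theorem IsLocalHomeomorph.strict_monotone_on_graph {F : ℝ × ℝ → ℝ × ℝ} (hF : IsLocalHomeomorph F)
    {k R : ℝ} {X : ℝ → ℝ} (hX : ContinuousOn X (Ioi R))
    (hlev : ∀ y, R < y → ∀ x, (F (x, y)).1 = k ↔ x = X y) :
    (∀ p q : ℝ × ℝ, (F p).1 = k → (F q).1 = k → R < p.2 → p.2 < q.2 → (F p).2 < (F q).2) ∨
    (∀ p q : ℝ × ℝ, (F p).1 = k → (F q).1 = k → R < p.2 → p.2 < q.2 → (F q).2 < (F p).2) := by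
  have hcont : ContinuousOn (fun y => (F (X y, y)).2) (Ioi R) := by
    have := hF.continuous
    fun_prop
  have key : ∀ c, R < c → ¬ IsLocalExtr (fun y => (F (X y, y)).2) c := by
    intro c hc hext
    have hev : ∀ P : ℝ → Prop, (∀ᶠ y in 𝓝 c, P ((F (X y, y)).2)) →
        ∃ ε > 0, ∀ s, |s - (F (X c, c)).2| < ε → P s := by
      intro P hP
      have hP' := hP.and (lt_mem_nhds hc)
      have hU : {q : ℝ × ℝ | P ((F (X q.2, q.2)).2) ∧ R < q.2} ∈ 𝓝 (X c, c) :=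
        (continuous_snd.tendsto (X c, c)).eventually hP'
      obtain ⟨ε, hε, h⟩ := hF.exists_mem_fst_eq_snd_lt hU
      refine ⟨ε, hε, fun s hs => ?_⟩
      obtain ⟨q, ⟨hq1, hq2⟩, hq3, hq4⟩ := h s hs
      rw [(hlev c hc _).2 rfl] at hq3
      have := (hlev q.2 hq2 q.1).1 hq3
      rw [← this] at hq1
      rw [← hq4]; exact hq1
    rcases hext with h | h
    · obtain ⟨ε, hε, h'⟩ := hev (fun s => (F (X c, c)).2 ≤ s) h
      have := h' ((F (X c, c)).2 - ε / 2) (by rw [abs_lt]; constructor <;> linarith)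
      linarith
    · obtain ⟨ε, hε, h'⟩ := hev (fun s => s ≤ (F (X c, c)).2) h
      have := h' ((F (X c, c)).2 + ε / 2) (by rw [abs_lt]; constructor <;> linarith)
      linarith
  have hinj : ∀ a b, R < a → a < b → (F (X a, a)).2 ≠ (F (X b, b)).2 := by
    intro a b ha hab he
    obtain ⟨c, hc, hext⟩ := exists_isLocalExtr_Ioo hab
      (hcont.mono fun y hy => ha.trans_le hy.1) he
    exact key c (ha.trans hc.1) hext
  have hψc : Continuous fun t => (F (X (R + Real.exp t), R + Real.exp t)).2 := by
    refine hcont.comp_continuous (f := fun t => R + Real.exp t) (by fun_prop) fun t => ?_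
    simp [Real.exp_pos]
  have hψi : Function.Injective fun t => (F (X (R + Real.exp t), R + Real.exp t)).2 := by
    intro s t hst
    by_contra hne
    rcases lt_or_gt_of_ne hne with h | h
    · exact hinj (R + Real.exp s) (R + Real.exp t) (by simp [Real.exp_pos]) (by simpa using h) hst
    · exact hinj (R + Real.exp t) (R + Real.exp s) (by simp [Real.exp_pos]) (by simpa using h)
        hst.symm
  have hrep : ∀ p : ℝ × ℝ, (F p).1 = k → R < p.2 →
      F p = F (X (R + Real.exp (Real.log (p.2 - R))), R + Real.exp (Real.log (p.2 - R))) := by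
    intro p hp hR
    rw [Real.exp_log (by linarith), add_sub_cancel, ← (hlev p.2 hR p.1).1 hp]
  rcases hψc.strictMono_of_inj hψi with hm | hm
  · left
    intro p q hp hq hRp hpq
    rw [hrep p hp hRp, hrep q hq (hRp.trans hpq)]
    exact hm (Real.log_lt_log (by linarith) (by linarith))
  · right
    intro p q hp hq hRp hpq
    rw [hrep p hp hRp, hrep q hq (hRp.trans hpq)]
    exact hm (Real.log_lt_log (by linarith) (by linarith))

open Set Filter Topology in
theorem not_injOn_level_aux {F : ℝ × ℝ → ℝ × ℝ} (hF : IsLocalHomeomorph F) {k R : ℝ}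
    (hcpt : ∀ a b : ℝ, IsCompact {p : ℝ × ℝ | (F p).1 = k ∧ a ≤ p.2 ∧ p.2 ≤ b})
    (htop : ∀ p q : ℝ × ℝ, (F p).1 = k → (F q).1 = k → R < p.2 → p.2 < q.2 → (F p).2 < (F q).2)
    (htopu : ∀ p q : ℝ × ℝ, (F p).1 = k → (F q).1 = k → R < p.2 → p.2 = q.2 → p = q)
    (hbot : (∀ p q : ℝ × ℝ, (F p).1 = k → (F q).1 = k → q.2 < -R → p.2 < q.2 →
        (F p).2 < (F q).2) ∨
      (∀ p q : ℝ × ℝ, (F p).1 = k → (F q).1 = k → q.2 < -R → p.2 < q.2 → (F q).2 < (F p).2))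
    (hex : ∀ y, ∃ x, (F (x, y)).1 = k)
    {p₀ q₀ : ℝ × ℝ} (hne : p₀ ≠ q₀) (hp₀ : (F p₀).1 = k) (heq : F p₀ = F q₀)
    (hR : |p₀.2| ≤ R) : False := by
  have hFc := hF.continuous
  have hq₀ : (F q₀).1 = k := by rw [← heq]; exact hp₀
  have hR0 : 0 ≤ R := (abs_nonneg _).trans hR
  have nomax : ∀ p : ℝ × ℝ, (F p).1 = k → (∀ q : ℝ × ℝ, (F q).1 = k → (F q).2 ≤ (F p).2) →
      False := by
    intro p hp h
    obtain ⟨ε, hε, h'⟩ := hF.exists_mem_fst_eq_snd_lt (p := p) univ_mem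
    obtain ⟨q, -, h1, h2⟩ := h' ((F p).2 + ε / 2) (by rw [abs_lt]; constructor <;> linarith)
    have := h q (h1.trans hp)
    linarith
  have nomin : ∀ p : ℝ × ℝ, (F p).1 = k → (∀ q : ℝ × ℝ, (F q).1 = k → (F p).2 ≤ (F q).2) →
      False := by
    intro p hp h
    obtain ⟨ε, hε, h'⟩ := hF.exists_mem_fst_eq_snd_lt (p := p) univ_mem
    obtain ⟨q, -, h1, h2⟩ := h' ((F p).2 - ε / 2) (by rw [abs_lt]; constructor <;> linarith)
    have := h q (h1.trans hp)
    linarith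
  have hp₀m : p₀ ∈ {p : ℝ × ℝ | (F p).1 = k ∧ -(R + 1) ≤ p.2 ∧ p.2 ≤ R + 1} := by
    have := abs_le.1 hR
    exact ⟨hp₀, by linarith, by linarith⟩
  obtain ⟨m, ⟨hm1, hm2, hm3⟩, hmin⟩ := (hcpt (-(R + 1)) (R + 1)).exists_isMinOn ⟨p₀, hp₀m⟩
    (f := fun p => (F p).2) (by fun_prop)
  have hmin' : ∀ p : ℝ × ℝ, (F p).1 = k → -(R + 1) ≤ p.2 → (F m).2 ≤ (F p).2 := by
    intro p hp h1
    by_cases h2 : p.2 ≤ R + 1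
    · exact hmin ⟨hp, h1, h2⟩
    · obtain ⟨x, hx⟩ := hex (R + 1)
      have a1 := htop (x, R + 1) p hx hp (by simp) (by simpa using h2)
      have a2 : (F m).2 ≤ (F (x, R + 1)).2 := hmin ⟨hx, by simp; linarith, by simp⟩
      linarith
  obtain ⟨xm, hxm⟩ := hex (-(R + 1))
  have hbot' : ∀ p q : ℝ × ℝ, (F p).1 = k → (F q).1 = k → q.2 < -R → p.2 < q.2 →
      (F p).2 < (F q).2 := by
    rcases hbot with h | h
    · exact h
    · exfalso
      refine nomin m hm1 fun q hq => ?_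
      by_cases h1 : -(R + 1) ≤ q.2
      · exact hmin' q hq h1
      · have a1 := h q (xm, -(R + 1)) hq hxm (by simp) (by simpa using h1)
        have a2 := hmin' (xm, -(R + 1)) hxm (by simp)
        linarith
  -- a point on the lower end below the common value
  obtain ⟨l, hl1, hl2, hl3⟩ : ∃ l : ℝ × ℝ, (F l).1 = k ∧ l.2 < -(R + 1) ∧ (F l).2 < (F p₀).2 := by
    by_contra! hcon
    refine nomin m hm1 fun q hq => ?_
    by_cases h1 : -(R + 1) ≤ q.2
    · exact hmin' q hq h1
    · exact (hmin hp₀m : (F m).2 ≤ (F p₀).2).trans (hcon q hq (by simpa using h1))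
  have hlow : ∀ p : ℝ × ℝ, (F p).1 = k → (F p₀).2 ≤ (F p).2 → l.2 ≤ p.2 := by
    intro p hp h
    by_contra! h1
    have := hbot' p l hp hl1 (by linarith) h1
    linarith
  have hp₀l : p₀ ∈ {p : ℝ × ℝ | (F p).1 = k ∧ l.2 ≤ p.2 ∧ p.2 ≤ R + 1} :=
    ⟨hp₀, hlow p₀ hp₀ le_rfl, hp₀m.2.2⟩
  obtain ⟨M, ⟨hM1, hM2, hM3⟩, hmax⟩ := (hcpt l.2 (R + 1)).exists_isMaxOn ⟨p₀, hp₀l⟩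
    (f := fun p => (F p).2) (by fun_prop)
  have hMp : (F p₀).2 ≤ (F M).2 := hmax hp₀l
  obtain ⟨u, hu1, hu2, hu3⟩ : ∃ u : ℝ × ℝ, (F u).1 = k ∧ R + 1 < u.2 ∧ (F M).2 < (F u).2 := by
    by_contra! hcon
    refine nomax M hM1 fun q hq => ?_
    by_cases h1 : R + 1 < q.2
    · exact hcon q hq h1
    by_cases h2 : l.2 ≤ q.2
    · exact hmax ⟨hq, h2, not_lt.1 h1⟩
    · have := hbot' q l hq hl1 (by linarith) (not_le.1 h2)
      linarith
  set K := {p : ℝ × ℝ | (F p).1 = k ∧ l.2 ≤ p.2 ∧ p.2 ≤ u.2} with hK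
  have hKc : IsCompact K := hcpt _ _
  set T := {w : (ℝ × ℝ) × (ℝ × ℝ) | w.1 ≠ w.2 ∧ F w.1 = F w.2 ∧ (F p₀).2 ≤ (F w.1).2 ∧
    (F w.1).1 = k} with hT
  have hTK1 : ∀ p q : ℝ × ℝ, p ≠ q → F p = F q → (F p₀).2 ≤ (F p).2 → (F p).1 = k → p ∈ K := by
    intro p q hpq hFe h1 h2
    have hq2 : (F q).1 = k := by rw [← hFe]; exact h2
    refine ⟨h2, hlow p h2 h1, ?_⟩
    by_contra! h3
    have h4 := htop u p hu1 h2 (by linarith) h3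
    have h5 : R + 1 < q.2 := by
      by_contra! h5
      have : (F q).2 ≤ (F M).2 := hmax ⟨hq2, hlow q hq2 (by rw [← hFe]; exact h1), h5⟩
      rw [← hFe] at this
      linarith
    rcases lt_trichotomy p.2 q.2 with h6 | h6 | h6
    · have := htop p q h2 hq2 (by linarith) h6
      rw [hFe] at this; exact lt_irrefl _ this
    · exact hpq (htopu p q h2 hq2 (by linarith) h6)
    · have := htop q p hq2 h2 (by linarith) h6
      rw [hFe] at this; exact lt_irrefl _ this
  have hTK : T ⊆ K ×ˢ K := by
    rintro ⟨p, q⟩ ⟨h1, h2, h3, h4⟩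
    simp only at h1 h2 h3 h4
    exact ⟨hTK1 p q h1 h2 h3 h4, hTK1 q p h1.symm h2.symm (by rw [← h2]; exact h3)
      (by rw [← h2]; exact h4)⟩
  have hTclosed : IsClosed T := by
    have h1 : IsClosed {w : (ℝ × ℝ) × (ℝ × ℝ) | F w.1 = F w.2 ∧ (F p₀).2 ≤ (F w.1).2 ∧
        (F w.1).1 = k} := by
      have c1 : IsClosed {w : (ℝ × ℝ) × (ℝ × ℝ) | F w.1 = F w.2} :=
        isClosed_eq (by fun_prop) (by fun_prop)
      have c2 : IsClosed {w : (ℝ × ℝ) × (ℝ × ℝ) | (F p₀).2 ≤ (F w.1).2} :=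
        isClosed_le (by fun_prop) (by fun_prop)
      have c3 : IsClosed {w : (ℝ × ℝ) × (ℝ × ℝ) | (F w.1).1 = k} :=
        isClosed_eq (by fun_prop) (by fun_prop)
      exact c1.inter (c2.inter c3)
    rw [← closure_subset_iff_isClosed]
    rintro ⟨p, q⟩ hw
    have h2 := closure_minimal (fun w hw => hw.2) h1 hw
    refine ⟨?_, h2⟩
    simp only
    rintro rfl
    obtain ⟨U, hUo, hpU, hU⟩ := hF.isLocallyInjective p
    obtain ⟨⟨a, b⟩, ⟨ha, hb⟩, hab⟩ := mem_closure_iff_nhds.1 hw (U ×ˢ U)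
      (prod_mem_nhds (hUo.mem_nhds hpU) (hUo.mem_nhds hpU))
    exact hab.1 (hU ha hb hab.2.1)
  have hTc : IsCompact T := (hKc.prod hKc).of_isClosed_subset hTclosed hTK
  obtain ⟨⟨p, q⟩, ⟨h1, h2, h3, h4⟩, hpq⟩ := hTc.exists_isMaxOn ⟨(p₀, q₀), hne, heq, le_rfl, hp₀⟩
    (f := fun w => (F w.1).2) (by fun_prop)
  simp only at h1 h2 h3 h4
  obtain ⟨U, V, hU, hV, hpU, hqV, hUV⟩ := t2_separation h1
  obtain ⟨ε, hε, hp'⟩ := hF.exists_mem_fst_eq_snd_lt (hU.mem_nhds hpU)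
  obtain ⟨δ, hδ, hq'⟩ := hF.exists_mem_fst_eq_snd_lt (hV.mem_nhds hqV)
  have hmpos : 0 < min ε δ := lt_min hε hδ
  have hm1' := min_le_left ε δ
  have hm2' := min_le_right ε δ
  obtain ⟨a, haU, ha1, ha2⟩ := hp' ((F p).2 + min ε δ / 2)
    (by rw [abs_lt]; constructor <;> linarith)
  obtain ⟨b, hbV, hb1, hb2⟩ := hq' ((F p).2 + min ε δ / 2)
    (by rw [h2, abs_lt]; constructor <;> linarith)
  have hab : (a, b) ∈ T := by
    refine ⟨fun hab => ?_, ?_, ?_, ?_⟩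
    · simp only at hab
      subst hab
      exact disjoint_left.1 hUV haU hbV
    · exact Prod.ext (by rw [ha1, hb1, h2]) (by rw [ha2, hb2])
    · simp only; rw [ha2]; linarith
    · exact ha1.trans h4
  have : (F a).2 ≤ (F p).2 := hpq hab
  rw [ha2] at this
  linarith

open Set Filter Topology in
/-- A local homeomorphism `F` of the plane is injective if, on each level set of its first
component, the projection to the second coordinate is proper and, outside a bounded set, injective,
while the first component changes sign along each horizontal line. -/
theorem IsLocalHomeomorph.injective_of_levels {F : ℝ × ℝ → ℝ × ℝ} (hF : IsLocalHomeomorph F)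
    (huniq : ∀ k, ∃ R, ∀ y, R ≤ |y| → ∀ x x', (F (x, y)).1 = k → (F (x', y)).1 = k → x = x')
    (hcoer : ∀ k M, ∃ B, ∀ x y, |y| ≤ M →
      (B ≤ x → k < (F (x, y)).1) ∧ (x ≤ -B → (F (x, y)).1 < k)) :
    Function.Injective F := by
  intro p₀ q₀ heq
  by_contra hne
  have hFc := hF.continuous
  obtain ⟨k, hk⟩ : ∃ k, (F p₀).1 = k := ⟨_, rfl⟩
  obtain ⟨R', hR'⟩ := huniq k
  obtain ⟨R, hR1, hR2⟩ : ∃ R, R' ≤ R ∧ |p₀.2| ≤ R := ⟨max R' |p₀.2|, le_max_left _ _, le_max_right _ _⟩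
  have huR : ∀ y, R ≤ |y| → ∀ x x', (F (x, y)).1 = k → (F (x', y)).1 = k → x = x' :=
    fun y hy => hR' y (hR1.trans hy)
  have hex : ∀ y a, k < (F (a, y)).1 → ∃ x < a, (F (x, y)).1 = k := by
    intro y a ha
    obtain ⟨B, hB⟩ := hcoer k |y|
    have h1 := (hB (min (-B) (a - 1)) y le_rfl).2 (min_le_left _ _)
    obtain ⟨x, hx, hx'⟩ := intermediate_value_Icc (f := fun x => (F (x, y)).1)
      (show min (-B) (a - 1) ≤ a by linarith [min_le_right (-B) (a - 1)]) (by fun_prop)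
      ⟨h1.le, ha.le⟩
    refine ⟨x, lt_of_le_of_ne hx.2 ?_, hx'⟩
    rintro rfl
    simp only at hx'
    exact ha.ne' hx'
  have hex' : ∀ y a, (F (a, y)).1 < k → ∃ x > a, (F (x, y)).1 = k := by
    intro y a ha
    obtain ⟨B, hB⟩ := hcoer k |y|
    have h1 := (hB (max B (a + 1)) y le_rfl).1 (le_max_left _ _)
    obtain ⟨x, hx, hx'⟩ := intermediate_value_Icc (f := fun x => (F (x, y)).1)
      (show a ≤ max B (a + 1) by linarith [le_max_right B (a + 1)]) (by fun_prop)
      ⟨ha.le, h1.le⟩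
    refine ⟨x, lt_of_le_of_ne hx.1 ?_, hx'⟩
    rintro rfl
    simp only at hx'
    exact ha.ne hx'
  have hex0 : ∀ y, ∃ x, (F (x, y)).1 = k := by
    intro y
    obtain ⟨B, hB⟩ := hcoer k |y|
    obtain ⟨x, -, hx⟩ := hex y _ ((hB B y le_rfl).1 le_rfl)
    exact ⟨x, hx⟩
  choose X hX using hex0
  have hlev : ∀ y, R ≤ |y| → ∀ x, (F (x, y)).1 = k ↔ x = X y := fun y hy x =>
    ⟨fun h => huR y hy x _ h (hX y), fun h => by rw [h]; exact hX y⟩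
  have hgt : ∀ y, R ≤ |y| → ∀ x, k < (F (x, y)).1 ↔ X y < x := by
    intro y hy x
    constructor
    · intro h
      obtain ⟨x', hx', h'⟩ := hex y x h
      rwa [← (hlev y hy x').1 h']
    · intro h
      by_contra! h'
      rcases h'.lt_or_eq with h' | h'
      · obtain ⟨x', hx', h''⟩ := hex' y x h'
        rw [(hlev y hy x').1 h''] at hx'
        exact lt_asymm h hx'
      · exact h.ne' ((hlev y hy x).1 h')
  have hlt : ∀ y, R ≤ |y| → ∀ x, (F (x, y)).1 < k ↔ x < X y := by
    intro y hy x
    rw [← not_iff_not, not_lt, not_lt, le_iff_lt_or_eq, le_iff_lt_or_eq, hgt y hy x, eq_comm,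
      hlev y hy x, @eq_comm _ (X y)]
  have hXc : ContinuousOn X {y | R ≤ |y|} := by
    intro y hy
    refine tendsto_order.2 ⟨fun a ha => ?_, fun a ha => ?_⟩
    · have h1 := (hlt y hy a).2 ha
      have h2 : ∀ᶠ z in 𝓝 y, (F (a, z)).1 < k :=
        (show Continuous fun z => (F (a, z)).1 by fun_prop).continuousAt.eventually_lt_const h1
      filter_upwards [nhdsWithin_le_nhds h2, self_mem_nhdsWithin] with z hz hz'
      exact (hlt z hz' a).1 hz
    · have h1 := (hgt y hy a).2 ha
      have h2 : ∀ᶠ z in 𝓝 y, k < (F (a, z)).1 :=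
        (show Continuous fun z => (F (a, z)).1 by fun_prop).continuousAt.eventually_const_lt h1
      filter_upwards [nhdsWithin_le_nhds h2, self_mem_nhdsWithin] with z hz hz'
      exact (hgt z hz' a).1 hz
  have hcpt : ∀ a b : ℝ, IsCompact {p : ℝ × ℝ | (F p).1 = k ∧ a ≤ p.2 ∧ p.2 ≤ b} := by
    intro a b
    obtain ⟨B, hB⟩ := hcoer k (max |a| |b|)
    refine (isCompact_Icc (a := ((-B, a) : ℝ × ℝ)) (b := (B, b))).of_isClosed_subset ?_ ?_
    · have c1 : IsClosed {p : ℝ × ℝ | (F p).1 = k} := isClosed_eq (by fun_prop) (by fun_prop)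
      have c2 : IsClosed {p : ℝ × ℝ | a ≤ p.2} := isClosed_le (by fun_prop) (by fun_prop)
      have c3 : IsClosed {p : ℝ × ℝ | p.2 ≤ b} := isClosed_le (by fun_prop) (by fun_prop)
      exact c1.inter (c2.inter c3)
    · rintro ⟨x, y⟩ ⟨h1, h2, h3⟩
      have := hB x y (abs_le_max_abs_abs h2 h3)
      refine ⟨⟨?_, h2⟩, ⟨?_, h3⟩⟩
      · by_contra! h; exact (this.2 h.le).ne h1
      · by_contra! h; exact (this.1 h.le).ne' h1
  have hxpos : ∀ y, R < y → R ≤ |y| := fun y hy => hy.le.trans (le_abs_self y)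
  have hxneg : ∀ y, y < -R → R ≤ |y| := fun y hy => by linarith [neg_le_abs y]
  have htop := hF.strict_monotone_on_graph (k := k) (R := R) (X := X)
    (hXc.mono fun y hy => hxpos y hy) fun y hy => hlev y (hxpos y hy)
  have htopu : ∀ p q : ℝ × ℝ, (F p).1 = k → (F q).1 = k → R < p.2 → p.2 = q.2 → p = q := by
    rintro ⟨x, y⟩ ⟨x', y'⟩ h1 h2 h3 h4
    simp only at h3 h4
    subst h4
    rw [huR y (hxpos y h3) x x' h1 h2]
  let refl : ℝ × ℝ ≃ₜ ℝ × ℝ := (Homeomorph.refl ℝ).prodCongr (Homeomorph.neg ℝ)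
  have hbot0 := (hF.comp refl.isLocalHomeomorph).strict_monotone_on_graph (k := k) (R := R)
    (X := fun y => X (-y))
    (hXc.comp (continuous_neg.continuousOn) fun y (hy : R < y) => by
      simpa using hxpos y hy)
    (fun y hy x => hlev (-y) (by simpa using hxpos y hy) x)
  have hbot : (∀ p q : ℝ × ℝ, (F p).1 = k → (F q).1 = k → q.2 < -R → p.2 < q.2 →
        (F p).2 < (F q).2) ∨
      (∀ p q : ℝ × ℝ, (F p).1 = k → (F q).1 = k → q.2 < -R → p.2 < q.2 → (F q).2 < (F p).2) := by
    have hre : ∀ p : ℝ × ℝ, (F ∘ refl) (p.1, -p.2) = F p := fun p => by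
      simp [refl]
    rcases hbot0 with h | h
    · right
      intro p q hp hq h1 h2
      have := h (q.1, -q.2) (p.1, -p.2) (by rw [hre]; exact hq) (by rw [hre]; exact hp)
        (by simp only; linarith) (by simpa using h2)
      rwa [hre, hre] at this
    · left
      intro p q hp hq h1 h2
      have := h (q.1, -q.2) (p.1, -p.2) (by rw [hre]; exact hq) (by rw [hre]; exact hp)
        (by simp only; linarith) (by simpa using h2)
      rwa [hre, hre] at this
  rcases htop with htop | htop
  · exact not_injOn_level_aux hF hcpt htop htopu hbot (fun y => ⟨X y, hX y⟩) hne hk heq hR2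
  · let sw : ℝ × ℝ ≃ₜ ℝ × ℝ := (Homeomorph.refl ℝ).prodCongr (Homeomorph.neg ℝ)
    have h1 : ∀ p, ((sw ∘ F) p).1 = (F p).1 := fun p => rfl
    have h2 : ∀ p, ((sw ∘ F) p).2 = -(F p).2 := fun p => rfl
    refine not_injOn_level_aux (F := sw ∘ F) (k := k) (R := R) (sw.isLocalHomeomorph.comp hF)
      hcpt ?_ htopu ?_ (fun y => ⟨X y, hX y⟩) hne hk (congrArg sw heq) hR2
    · intro p q a b c d
      rw [h2, h2, neg_lt_neg_iff]
      exact htop p q a b c d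
    · simp only [h2, neg_lt_neg_iff]
      exact hbot.symm

/-- A pair of `C¹` functions on the plane with nowhere vanishing Jacobian determinant, the second
of which restricts to a polynomial along every polynomial curve. -/
structure JacPair (f g : ℝ × ℝ → ℝ) : Prop where
  contDiff_left : ContDiff ℝ 1 f
  contDiff_right : ContDiff ℝ 1 g
  jac_ne_zero : ∀ p, fderiv ℝ f p (1, 0) * fderiv ℝ g p (0, 1) -
    fderiv ℝ f p (0, 1) * fderiv ℝ g p (1, 0) ≠ 0
  polynomial_right : ∀ u v : Polynomial ℝ, ∃ w : Polynomial ℝ,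
    ∀ t, g (u.eval t, v.eval t) = w.eval t

theorem ContDiff.hasDerivAt_curve {f : ℝ × ℝ → ℝ} (hf : ContDiff ℝ 1 f) {x y : ℝ → ℝ}
    {x' y' t : ℝ} (hx : HasDerivAt x x' t) (hy : HasDerivAt y y' t) :
    HasDerivAt (fun t => f (x t, y t))
      (fderiv ℝ f (x t, y t) (1, 0) * x' + fderiv ℝ f (x t, y t) (0, 1) * y') t := by
  have h := ((hf.differentiable one_ne_zero) (x t, y t)).hasFDerivAt.comp_hasDerivAt t
    (hx.prodMk hy)
  have e : ((x', y') : ℝ × ℝ) = x' • (1, 0) + y' • (0, 1) := by simp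
  rw [e, map_add, map_smul, map_smul] at h
  simp only [smul_eq_mul] at h
  exact h.congr_deriv (by ring)

namespace JacPair

variable {f g : ℝ × ℝ → ℝ}

theorem fderiv_fst_eq (hf : ContDiff ℝ 1 f) {x y d : ℝ} (h : HasDerivAt (fun x => f (x, y)) d x) :
    fderiv ℝ f (x, y) (1, 0) = d := by
  have h1 := hf.hasDerivAt_curve (hasDerivAt_id x) (hasDerivAt_const x y)
  simpa using h1.unique h

theorem fderiv_snd_eq (hf : ContDiff ℝ 1 f) {x y d : ℝ} (h : HasDerivAt (fun y => f (x, y)) d y) :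
    fderiv ℝ f (x, y) (0, 1) = d := by
  have h1 := hf.hasDerivAt_curve (hasDerivAt_const y x) (hasDerivAt_id y)
  simpa using h1.unique h

theorem isLocalHomeomorph (h : JacPair f g) : IsLocalHomeomorph fun p => (f p, g p) := by
  refine IsLocalHomeomorph.mk _ fun p => ?_
  have h1 : HasStrictFDerivAt (fun p => (f p, g p)) ((fderiv ℝ f p).prod (fderiv ℝ g p)) p :=
    (h.contDiff_left.contDiffAt.hasStrictFDerivAt one_ne_zero).prodMk
      (h.contDiff_right.contDiffAt.hasStrictFDerivAt one_ne_zero)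
  have hinj : Function.Injective (((fderiv ℝ f p).prod (fderiv ℝ g p)) : ℝ × ℝ →ₗ[ℝ] ℝ × ℝ) := by
    rw [injective_iff_map_eq_zero]
    rintro ⟨a, b⟩ hab
    have e : ((a, b) : ℝ × ℝ) = a • (1, 0) + b • (0, 1) := by simp
    obtain ⟨h2, h3⟩ : fderiv ℝ f p (a, b) = 0 ∧ fderiv ℝ g p (a, b) = 0 := by simpa using hab
    rw [e, map_add, map_smul, map_smul, smul_eq_mul, smul_eq_mul] at h2 h3
    have h4 := h.jac_ne_zero p
    set fx := fderiv ℝ f p (1, 0)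
    set fy := fderiv ℝ f p (0, 1)
    set gx := fderiv ℝ g p (1, 0)
    set gy := fderiv ℝ g p (0, 1)
    have ha : (fx * gy - fy * gx) * a = 0 := by linear_combination gy * h2 - fy * h3
    have hb : (fx * gy - fy * gx) * b = 0 := by linear_combination fx * h3 - gx * h2
    simp only [mul_eq_zero, h4, false_or] at ha hb
    simp [ha, hb]
  let e : (ℝ × ℝ) ≃L[ℝ] (ℝ × ℝ) :=
    (LinearEquiv.ofInjectiveEndo _ hinj).toContinuousLinearEquiv
  have he : (e : ℝ × ℝ →L[ℝ] ℝ × ℝ) = (fderiv ℝ f p).prod (fderiv ℝ g p) := by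
    ext <;> rfl
  rw [← he] at h1
  exact ⟨h1.toOpenPartialHomeomorph _, h1.mem_toOpenPartialHomeomorph_source,
    fun q _ => rfl⟩

theorem not_critical (h : JacPair f g) {x y : ℝ} (hx : HasDerivAt (fun x => f (x, y)) 0 x)
    (hy : HasDerivAt (fun y => f (x, y)) 0 y) : False := by
  apply h.jac_ne_zero (x, y)
  rw [fderiv_fst_eq h.contDiff_left hx, fderiv_snd_eq h.contDiff_left hy]
  ring

/-- The determinant of the Jacobian matrix has constant sign. -/
theorem jac_pos_or_neg (h : JacPair f g) :
    (∀ p, 0 < fderiv ℝ f p (1, 0) * fderiv ℝ g p (0, 1) -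
      fderiv ℝ f p (0, 1) * fderiv ℝ g p (1, 0)) ∨
    (∀ p, fderiv ℝ f p (1, 0) * fderiv ℝ g p (0, 1) -
      fderiv ℝ f p (0, 1) * fderiv ℝ g p (1, 0) < 0) := by
  have hc : Continuous fun p => fderiv ℝ f p (1, 0) * fderiv ℝ g p (0, 1) -
      fderiv ℝ f p (0, 1) * fderiv ℝ g p (1, 0) := by
    have := h.contDiff_left.continuous_fderiv one_ne_zero
    have := h.contDiff_right.continuous_fderiv one_ne_zero
    fun_prop
  by_contra! hcon
  obtain ⟨⟨p, hp⟩, q, hq⟩ := hcon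
  obtain ⟨r, hr⟩ := mem_range_of_exists_le_of_exists_ge hc ⟨p, hp⟩ ⟨q, hq⟩
  exact h.jac_ne_zero r hr

theorem neg_left (h : JacPair f g) : JacPair (fun p => -f p) g where
  contDiff_left := h.contDiff_left.neg
  contDiff_right := h.contDiff_right
  jac_ne_zero p := by
    have := h.jac_ne_zero p
    rw [fderiv_fun_neg]
    contrapose! this
    simp only [neg_apply] at this
    linarith
  polynomial_right := h.polynomial_right

theorem neg_right (h : JacPair f g) : JacPair f (fun p => -g p) where
  contDiff_left := h.contDiff_left
  contDiff_right := h.contDiff_right.neg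
  jac_ne_zero p := by
    have := h.jac_ne_zero p
    rw [fderiv_fun_neg]
    contrapose! this
    simp only [neg_apply] at this
    linarith
  polynomial_right u v := by
    obtain ⟨w, hw⟩ := h.polynomial_right u v
    exact ⟨-w, fun t => by simp [hw]⟩

theorem comp (h : JacPair f g) {φ ψ : ℝ × ℝ → ℝ} (hφ : ContDiff ℝ 1 φ) (hψ : ContDiff ℝ 1 ψ)
    (hdet : ∀ p, fderiv ℝ φ p (1, 0) * fderiv ℝ ψ p (0, 1) -
      fderiv ℝ φ p (0, 1) * fderiv ℝ ψ p (1, 0) ≠ 0)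
    (hpoly : ∀ u v : Polynomial ℝ, ∃ u' v' : Polynomial ℝ, ∀ t,
      φ (u.eval t, v.eval t) = u'.eval t ∧ ψ (u.eval t, v.eval t) = v'.eval t) :
    JacPair (fun p => f (φ p, ψ p)) (fun p => g (φ p, ψ p)) where
  contDiff_left := h.contDiff_left.comp (hφ.prodMk hψ)
  contDiff_right := h.contDiff_right.comp (hφ.prodMk hψ)
  jac_ne_zero := by
    rintro ⟨x, y⟩
    have key : ∀ F : ℝ × ℝ → ℝ, ContDiff ℝ 1 F →
        fderiv ℝ (fun p => F (φ p, ψ p)) (x, y) (1, 0) =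
          fderiv ℝ F (φ (x, y), ψ (x, y)) (1, 0) * fderiv ℝ φ (x, y) (1, 0) +
          fderiv ℝ F (φ (x, y), ψ (x, y)) (0, 1) * fderiv ℝ ψ (x, y) (1, 0) ∧
        fderiv ℝ (fun p => F (φ p, ψ p)) (x, y) (0, 1) =
          fderiv ℝ F (φ (x, y), ψ (x, y)) (1, 0) * fderiv ℝ φ (x, y) (0, 1) +
          fderiv ℝ F (φ (x, y), ψ (x, y)) (0, 1) * fderiv ℝ ψ (x, y) (0, 1) := by
      intro F hF
      have hx := hasDerivAt_id x
      have hy := hasDerivAt_id y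
      have hx0 := hasDerivAt_const x y
      have hy0 := hasDerivAt_const y x
      constructor
      · refine fderiv_fst_eq (hF.comp (hφ.prodMk hψ)) ?_
        have := hF.hasDerivAt_curve (hφ.hasDerivAt_curve hx hx0) (hψ.hasDerivAt_curve hx hx0)
        simpa using this
      · refine fderiv_snd_eq (hF.comp (hφ.prodMk hψ)) ?_
        have := hF.hasDerivAt_curve (hφ.hasDerivAt_curve hy0 hy) (hψ.hasDerivAt_curve hy0 hy)
        simpa using this
    rw [(key f h.contDiff_left).1, (key f h.contDiff_left).2, (key g h.contDiff_right).1,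
      (key g h.contDiff_right).2]
    have := mul_ne_zero (h.jac_ne_zero (φ (x, y), ψ (x, y))) (hdet (x, y))
    contrapose! this
    linear_combination this
  polynomial_right u v := by
    obtain ⟨u', v', h'⟩ := hpoly u v
    obtain ⟨w, hw⟩ := h.polynomial_right u' v'
    exact ⟨w, fun t => by rw [(h' t).1, (h' t).2, hw]⟩

theorem swap (h : JacPair f g) : JacPair (fun p => f (p.2, p.1)) (fun p => g (p.2, p.1)) := by
  refine h.comp (φ := fun p => p.2) (ψ := fun p => p.1) contDiff_snd contDiff_fst (fun p => ?_)
    fun u v => ⟨v, u, fun t => ⟨rfl, rfl⟩⟩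
  simp [fderiv_fst, fderiv_snd]

theorem reflect (h : JacPair f g) : JacPair (fun p => f (-p.1, p.2)) (fun p => g (-p.1, p.2)) := by
  refine h.comp (φ := fun p => -p.1) (ψ := fun p => p.2) contDiff_fst.neg contDiff_snd (fun p => ?_)
    fun u v => ⟨-u, v, fun t => by simp⟩
  simp [fderiv_fst, fderiv_snd, fderiv_fun_neg]

theorem shear (h : JacPair f g) (s : Polynomial ℝ) :
    JacPair (fun p => f (p.1, p.2 + s.eval p.1)) (fun p => g (p.1, p.2 + s.eval p.1)) := by
  have hs : ContDiff ℝ 1 fun p : ℝ × ℝ => p.2 + s.eval p.1 := by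
    have := s.contDiff_aeval (𝕜 := ℝ) 1
    simp only [Polynomial.coe_aeval_eq_eval] at this
    fun_prop
  refine h.comp (φ := fun p => p.1) (ψ := fun p => p.2 + s.eval p.1) contDiff_fst hs
    (fun p => ?_) fun u v => ⟨u, v + s.comp u, fun t => by simp⟩
  rw [fderiv_snd_eq (d := 1) hs ((hasDerivAt_id p.2).add_const (s.eval p.1))]
  simp [fderiv_fst]

theorem not_critical_cubic (h : JacPair f g) {a₀ a₁ a₂ a₃ : Polynomial ℝ}
    (hf : ∀ x y, f (x, y) = a₃.eval x * y ^ 3 + a₂.eval x * y ^ 2 + a₁.eval x * y + a₀.eval x)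
    {x y : ℝ} (hx : a₃.derivative.eval x * y ^ 3 + a₂.derivative.eval x * y ^ 2 +
      a₁.derivative.eval x * y + a₀.derivative.eval x = 0)
    (hy : 3 * a₃.eval x * y ^ 2 + 2 * a₂.eval x * y + a₁.eval x = 0) : False := by
  apply h.not_critical (x := x) (y := y)
  · simp only [hf]
    rw [← hx]
    exact ((((a₃.hasDerivAt x).mul_const _).add ((a₂.hasDerivAt x).mul_const _)).add
      ((a₁.hasDerivAt x).mul_const _)).add (a₀.hasDerivAt x)
  · simp only [hf]
    rw [← hy]
    have h1 := ((((hasDerivAt_pow 3 y).const_mul (a₃.eval x)).add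
      ((hasDerivAt_pow 2 y).const_mul (a₂.eval x))).add
      ((hasDerivAt_id y).const_mul (a₁.eval x))).add_const (a₀.eval x)
    exact h1.congr_deriv (by push_cast; ring)

end JacPair

theorem MvPolynomial.hasDerivAt_eval_curve (f : MvPolynomial (Fin 2) ℝ) {x y : ℝ → ℝ}
    {x' y' t : ℝ} (hx : HasDerivAt x x' t) (hy : HasDerivAt y y' t) :
    HasDerivAt (fun t => eval ![x t, y t] f)
      (eval ![x t, y t] (pderiv 0 f) * x' + eval ![x t, y t] (pderiv 1 f) * y') t := by
  induction f using MvPolynomial.induction_on with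
  | C a => simpa using hasDerivAt_const t a
  | add p q hp hq =>
    simp only [map_add]
    exact (hp.add hq).congr_deriv (by ring)
  | mul_X p i hp =>
    simp only [map_mul, eval_X, Derivation.leibniz, smul_eq_mul, map_add, pderiv_X]
    fin_cases i
    · exact (hp.mul hx).congr_deriv (by simp; ring)
    · exact (hp.mul hy).congr_deriv (by simp; ring)

theorem MvPolynomial.contDiff_eval_pair (f : MvPolynomial (Fin 2) ℝ) :
    ContDiff ℝ 1 fun p : ℝ × ℝ => eval ![p.1, p.2] f := by
  induction f using MvPolynomial.induction_on with
  | C a => simpa using contDiff_const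
  | add p q hp hq => simpa using hp.add hq
  | mul_X p i hp =>
    simp only [map_mul, eval_X]
    fin_cases i
    · exact hp.mul contDiff_fst
    · exact hp.mul contDiff_snd

theorem MvPolynomial.eval_pair_eq_eval_aeval (f : MvPolynomial (Fin 2) ℝ) (u v : Polynomial ℝ)
    (t : ℝ) : eval ![u.eval t, v.eval t] f = (aeval ![u, v] f).eval t := by
  induction f using MvPolynomial.induction_on with
  | C a => simp
  | add p q hp hq => simp [hp, hq]
  | mul_X p i hp =>
    fin_cases i <;> simp [hp]

theorem JacPair.of_mvPolynomial {f g : MvPolynomial (Fin 2) ℝ}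
    (hJ : ∀ p : Fin 2 → ℝ, eval p (pderiv 0 f * pderiv 1 g - pderiv 1 f * pderiv 0 g) ≠ 0) :
    JacPair (fun p => eval ![p.1, p.2] f) (fun p => eval ![p.1, p.2] g) where
  contDiff_left := f.contDiff_eval_pair
  contDiff_right := g.contDiff_eval_pair
  jac_ne_zero := by
    rintro ⟨x, y⟩
    have key : ∀ F : MvPolynomial (Fin 2) ℝ,
        fderiv ℝ (fun p : ℝ × ℝ => eval ![p.1, p.2] F) (x, y) (1, 0) =
          eval ![x, y] (pderiv 0 F) ∧
        fderiv ℝ (fun p : ℝ × ℝ => eval ![p.1, p.2] F) (x, y) (0, 1) =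
          eval ![x, y] (pderiv 1 F) := fun F =>
      ⟨JacPair.fderiv_fst_eq F.contDiff_eval_pair
        (by simpa using F.hasDerivAt_eval_curve (hasDerivAt_id x) (hasDerivAt_const x y)),
       JacPair.fderiv_snd_eq F.contDiff_eval_pair
        (by simpa using F.hasDerivAt_eval_curve (hasDerivAt_const y x) (hasDerivAt_id y))⟩
    rw [(key f).1, (key f).2, (key g).1, (key g).2]
    simpa using hJ ![x, y]
  polynomial_right u v := by
    exact ⟨aeval ![u, v] g, fun t => g.eval_pair_eq_eval_aeval u v t⟩

open Filter Topology in
theorem Polynomial.tendsto_eval_of_odd_natDegree {p : Polynomial ℝ} (hp : Odd p.natDegree)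
    (hlc : 0 < p.leadingCoeff) :
    Tendsto (fun x => p.eval x) atTop atTop ∧ Tendsto (fun x => p.eval x) atBot atBot := by
  have hdeg : 0 < p.degree := natDegree_pos_iff_degree_pos.1 hp.pos
  refine ⟨p.tendsto_atTop_of_leadingCoeff_nonneg hdeg hlc.le, ?_⟩
  have hX : (-X : Polynomial ℝ).natDegree = 1 := by simp
  have h1 : (p.comp (-X)).natDegree = p.natDegree := by simp [natDegree_comp]
  have h2 : (p.comp (-X)).leadingCoeff = -p.leadingCoeff := by
    rw [leadingCoeff_comp (by simp), leadingCoeff_neg, leadingCoeff_X, hp.neg_one_pow]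
    ring
  have h3 := (p.comp (-X)).tendsto_atBot_of_leadingCoeff_nonpos
    (natDegree_pos_iff_degree_pos.1 (by rw [h1]; exact hp.pos)) (by rw [h2]; linarith)
  have h4 := h3.comp tendsto_neg_atBot_atTop
  refine h4.congr fun x => ?_
  simp

theorem Polynomial.surjective_eval_of_odd_natDegree {p : Polynomial ℝ} (hp : Odd p.natDegree) :
    Function.Surjective fun x => p.eval x := by
  rcases lt_trichotomy 0 p.leadingCoeff with h | h | h
  · have := p.tendsto_eval_of_odd_natDegree hp h
    exact p.continuous.surjective this.1 this.2
  · rw [eq_comm, leadingCoeff_eq_zero] at h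
    simp [h] at hp
  · have := (-p).tendsto_eval_of_odd_natDegree (by simpa using hp) (by simpa using h)
    intro y
    obtain ⟨x, hx⟩ := (-p).continuous.surjective this.1 this.2 (-y)
    exact ⟨x, by simpa using hx⟩

theorem Polynomial.surjective_eval_of_derivative_ne_zero {p : Polynomial ℝ}
    (hp : ∀ x, p.derivative.eval x ≠ 0) : Function.Surjective fun x => p.eval x := by
  apply surjective_eval_of_odd_natDegree
  have h0 : p.natDegree ≠ 0 := fun h => hp 0 (by rw [derivative_of_natDegree_zero h, eval_zero])
  by_contra hodd
  rw [Nat.not_odd_iff_even] at hodd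
  have h1 : Odd p.derivative.natDegree := by
    rw [natDegree_derivative]
    exact Nat.Even.sub_odd (Nat.one_le_iff_ne_zero.2 h0) hodd odd_one
  obtain ⟨x, hx⟩ := surjective_eval_of_odd_natDegree h1 0
  exact hp x hx

theorem Polynomial.exists_odd_rootMultiplicity {p : Polynomial ℝ} (hp : Odd p.natDegree) :
    ∃ x, Odd (p.rootMultiplicity x) := by
  by_contra! hcon
  simp only [Nat.not_odd_iff_even] at hcon
  obtain ⟨q, hq1, hq2, hq3⟩ := p.exists_prod_multiset_X_sub_C_mul
  have h1 : Even p.roots.card := by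
    rw [← Multiset.toFinset_sum_count_eq]
    exact Finset.even_sum _ fun a _ => by rw [count_roots]; exact hcon a
  have h2 : Odd q.natDegree := by
    rw [← hq2] at hp
    exact (Nat.odd_add.1 hp |> fun h => by
      by_contra h'
      exact (Nat.not_odd_iff_even.2 h1) (h.2 (Nat.not_odd_iff_even.1 h')))
  obtain ⟨x, hx⟩ := surjective_eval_of_odd_natDegree h2 0
  have hq0 : q ≠ 0 := by rintro rfl; simp at h2
  have : x ∈ q.roots := (mem_roots hq0).2 hx
  simp [hq3] at this

/-- If the resultant in `y` of `A y² + B y + C` and `P + Q y` has odd degree, then it has a root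
of odd multiplicity, over which the two have a common zero unless `A` vanishes there. -/
theorem Polynomial.exists_common_zero_of_odd_natDegree {A B C P Q : Polynomial ℝ}
    (hodd : Odd (A * P ^ 2 - B * P * Q + C * Q ^ 2).natDegree) :
    ∃ x, Odd ((A * P ^ 2 - B * P * Q + C * Q ^ 2).rootMultiplicity x) ∧
      (A.eval x ≠ 0 → ∃ y, P.eval x + Q.eval x * y = 0 ∧
        A.eval x * y ^ 2 + B.eval x * y + C.eval x = 0) := by
  classical
  have hR0 : A * P ^ 2 - B * P * Q + C * Q ^ 2 ≠ 0 := by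
    intro h; simp [h] at hodd
  obtain ⟨E, P', Q', hP, hQ, hco⟩ : ∃ E P' Q', P = E * P' ∧ Q = E * Q' ∧ IsCoprime P' Q' := by
    refine ⟨EuclideanDomain.gcd P Q, P / EuclideanDomain.gcd P Q, Q / EuclideanDomain.gcd P Q,
      (EuclideanDomain.mul_div_cancel' ?_ (EuclideanDomain.gcd_dvd_left P Q)).symm,
      (EuclideanDomain.mul_div_cancel' ?_ (EuclideanDomain.gcd_dvd_right P Q)).symm, ?_⟩
    · intro h
      rw [EuclideanDomain.gcd_eq_zero_iff] at h
      exact hR0 (by rw [h.1, h.2]; ring)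
    · intro h
      rw [EuclideanDomain.gcd_eq_zero_iff] at h
      exact hR0 (by rw [h.1, h.2]; ring)
    · have hg : EuclideanDomain.gcd P Q ≠ 0 := by
        intro h
        rw [EuclideanDomain.gcd_eq_zero_iff] at h
        exact hR0 (by rw [h.1, h.2]; ring)
      refine ⟨EuclideanDomain.gcdA P Q, EuclideanDomain.gcdB P Q, ?_⟩
      apply mul_left_cancel₀ hg
      have h1 := EuclideanDomain.gcd_eq_gcd_ab P Q
      have h2 := EuclideanDomain.mul_div_cancel' hg (EuclideanDomain.gcd_dvd_left P Q)
      have h3 := EuclideanDomain.mul_div_cancel' hg (EuclideanDomain.gcd_dvd_right P Q)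
      linear_combination EuclideanDomain.gcdA P Q * h2 + EuclideanDomain.gcdB P Q * h3 - h1
  subst hP hQ
  set R := A * P' ^ 2 - B * P' * Q' + C * Q' ^ 2 with hR
  have hfac : A * (E * P') ^ 2 - B * (E * P') * (E * Q') + C * (E * Q') ^ 2 = E ^ 2 * R := by
    rw [hR]; ring
  rw [hfac] at hodd hR0 ⊢
  have hE0 : E ^ 2 ≠ 0 := left_ne_zero_of_mul hR0
  have hRne : R ≠ 0 := right_ne_zero_of_mul hR0
  have hRodd : Odd R.natDegree := by
    rw [natDegree_mul hE0 hRne, natDegree_pow, Nat.odd_add'] at hodd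
    exact hodd.2 (even_two_mul _)
  obtain ⟨x, hx⟩ := exists_odd_rootMultiplicity hRodd
  refine ⟨x, ?_, fun hA => ?_⟩
  · rw [rootMultiplicity_mul hR0, pow_two, rootMultiplicity_mul (by rwa [← pow_two]), Nat.odd_add']
    exact ⟨fun _ => ⟨_, rfl⟩, fun _ => hx⟩
  have hroot : R.eval x = 0 := by
    rw [← IsRoot.def, ← rootMultiplicity_pos hRne]
    exact hx.pos
  simp only [hR, eval_add, eval_sub, eval_mul, eval_pow] at hroot
  have hQ' : Q'.eval x ≠ 0 := by
    intro hQ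
    have hP' : P'.eval x = 0 := by simpa [hQ, hA] using hroot
    obtain ⟨a, b, hab⟩ := hco
    have := congrArg (fun p => p.eval x) hab
    simp [hQ, hP'] at this
  refine ⟨-(P'.eval x) / Q'.eval x, ?_, ?_⟩
  · simp only [eval_mul]
    field_simp
    ring
  · field_simp
    linear_combination hroot

theorem Polynomial.eventually_eval_ne_zero {A : Polynomial ℝ} (hA : A ≠ 0) (r : ℝ) :
    ∀ᶠ x in nhdsWithin r {r}ᶜ, A.eval x ≠ 0 := by
  have h1 : {x | A.IsRoot x}.Finite := by
    refine (A.roots.toFinset.finite_toSet).subset fun x hx => ?_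
    simpa [hA] using hx
  have h2 : ({x | A.IsRoot x} \ {r})ᶜ ∈ nhds r :=
    (h1.subset Set.sdiff_subset).isClosed.isOpen_compl.mem_nhds (by simp)
  filter_upwards [nhdsWithin_le_nhds h2, self_mem_nhdsWithin] with x hx hx' h
  exact hx ⟨h, hx'⟩

namespace JacPair

variable {f g : ℝ × ℝ → ℝ}

open Set Filter Topology in
theorem le_of_level (h : JacPair f g) (hJ : ∀ p, 0 < fderiv ℝ f p (1, 0) * fderiv ℝ g p (0, 1) -
      fderiv ℝ f p (0, 1) * fderiv ℝ g p (1, 0)) {Y : ℝ → ℝ} {a b k : ℝ} (hab : a ≤ b)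
    (hY : ∀ s ∈ Icc a b, DifferentiableAt ℝ Y s) (hk : ∀ s ∈ Icc a b, f (s, Y s) = k)
    (hfy : ∀ s ∈ Icc a b, 0 < fderiv ℝ f (s, Y s) (0, 1)) : g (b, Y b) ≤ g (a, Y a) := by
  have hd : ∀ s ∈ Icc a b, HasDerivAt (fun t => g (t, Y t))
      (fderiv ℝ g (s, Y s) (1, 0) * 1 + fderiv ℝ g (s, Y s) (0, 1) * deriv Y s) s := fun s hs =>
    h.contDiff_right.hasDerivAt_curve (hasDerivAt_id s) (hY s hs).hasDerivAt
  refine antitoneOn_of_deriv_nonpos (convex_Icc a b)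
    (fun s hs => (hd s hs).continuousAt.continuousWithinAt)
    (fun s hs => (hd s (interior_subset hs)).differentiableAt.differentiableWithinAt) ?_
    (left_mem_Icc.2 hab) (right_mem_Icc.2 hab) hab
  intro s hs
  have hs' := interior_subset hs
  rw [(hd s hs').deriv]
  have h1 := h.contDiff_left.hasDerivAt_curve (hasDerivAt_id s) (hY s hs').hasDerivAt
  have h2 : (fun t => f (t, Y t)) =ᶠ[𝓝 s] fun _ => k := by
    filter_upwards [isOpen_interior.mem_nhds hs] with t ht using hk t (interior_subset ht)
  have h3 := h1.unique ((hasDerivAt_const s k).congr_of_eventuallyEq h2)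
  simp only [id] at h3
  have h4 := hJ (s, Y s)
  have h5 := hfy s hs'
  set fx := fderiv ℝ f (s, Y s) (1, 0)
  set fy := fderiv ℝ f (s, Y s) (0, 1)
  set gx := fderiv ℝ g (s, Y s) (1, 0)
  set gy := fderiv ℝ g (s, Y s) (0, 1)
  have h6 : fy * (gx * 1 + gy * deriv Y s) = -(fx * gy - fy * gx) := by
    linear_combination gy * h3
  by_contra! h7
  have := mul_pos h5 h7
  linarith

/-- The restriction of the second component to a vertical line where `∂f/∂y` vanishes is a
surjective polynomial function. -/
theorem surjective_vertical (h : JacPair f g) {r : ℝ}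
    (hr : ∀ y, fderiv ℝ f (r, y) (0, 1) = 0) : Function.Surjective fun y => g (r, y) := by
  obtain ⟨w, hw⟩ := h.polynomial_right (Polynomial.C r) Polynomial.X
  simp only [Polynomial.eval_C, Polynomial.eval_X] at hw
  simp only [hw]
  refine Polynomial.surjective_eval_of_derivative_ne_zero fun y hy => ?_
  apply h.jac_ne_zero (r, y)
  have h1 : fderiv ℝ g (r, y) (0, 1) = w.derivative.eval y := by
    refine fderiv_snd_eq h.contDiff_right ?_
    simp only [hw]
    exact w.hasDerivAt y
  rw [hr, h1, hy]
  ring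

open Set Filter Topology in
theorem not_affine_of_pos (h : JacPair f g)
    (hJ : ∀ p, 0 < fderiv ℝ f p (1, 0) * fderiv ℝ g p (0, 1) -
      fderiv ℝ f p (0, 1) * fderiv ℝ g p (1, 0)) {A B : Polynomial ℝ}
    (hf : ∀ x y, f (x, y) = A.eval x * y + B.eval x) {r T : ℝ} (hr : A.eval r = 0) (hrT : r < T)
    (hpos : ∀ x ∈ Ioc r T, 0 < A.eval x) : False := by
  have hfy : ∀ x y, fderiv ℝ f (x, y) (0, 1) = A.eval x := fun x y => by
    refine fderiv_snd_eq h.contDiff_left ?_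
    simp only [hf]
    simpa using ((hasDerivAt_id y).const_mul (A.eval x)).add_const (B.eval x)
  have hA0 := (hpos T ⟨hrT, le_rfl⟩).ne'
  have hstep : ∀ y, ∀ t ∈ Ioc r T,
      g (T, (A.eval t * y + B.eval t - B.eval T) / A.eval T) ≤ g (t, y) := by
    intro y t ht
    have hne : ∀ s ∈ Icc t T, A.eval s ≠ 0 := fun s hs =>
      (hpos s ⟨ht.1.trans_le hs.1, hs.2⟩).ne'
    have := h.le_of_level hJ (Y := fun s => (A.eval t * y + B.eval t - B.eval s) / A.eval s)
      (k := A.eval t * y + B.eval t) ht.2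
      (fun s hs => ((B.differentiableAt).const_sub _).div A.differentiableAt (hne s hs))
      (fun s hs => by rw [hf]; have := hne s hs; field_simp; ring)
      (fun s hs => by rw [hfy]; exact hpos s ⟨ht.1.trans_le hs.1, hs.2⟩)
    have e : (A.eval t * y + B.eval t - B.eval t) / A.eval t = y := by
      have := hne t ⟨le_rfl, ht.2⟩
      field_simp
      ring
    rwa [e] at this
  have hlim : ∀ y, g (T, (B.eval r - B.eval T) / A.eval T) ≤ g (r, y) := by
    intro y
    have c1 : Continuous fun t => g (T, (A.eval t * y + B.eval t - B.eval T) / A.eval T) := by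
      have := h.contDiff_right.continuous
      have := A.continuous
      have := B.continuous
      fun_prop
    have c2 : Continuous fun t => g (t, y) := by
      have := h.contDiff_right.continuous
      fun_prop
    have t1 := (c1.tendsto r).mono_left (nhdsWithin_le_nhds (s := Ioi r))
    have t2 := (c2.tendsto r).mono_left (nhdsWithin_le_nhds (s := Ioi r))
    simp only [hr, zero_mul, zero_add] at t1
    refine le_of_tendsto_of_tendsto t1 t2 ?_
    filter_upwards [Ioc_mem_nhdsGT hrT] with t ht using hstep y t ht
  obtain ⟨y, hy⟩ := h.surjective_vertical (r := r) (fun y => by rw [hfy, hr])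
    (g (T, (B.eval r - B.eval T) / A.eval T) - 1)
  simp only at hy
  have := hlim y
  linarith

open Set Filter Topology in
/-- The first component of a Jacobian pair cannot be affine in `y` with a slope vanishing
somewhere but not everywhere. -/
theorem not_affine (h : JacPair f g) {A B : Polynomial ℝ}
    (hf : ∀ x y, f (x, y) = A.eval x * y + B.eval x) (hA : A ≠ 0) {r : ℝ} (hr : A.eval r = 0) :
    False := by
  obtain ⟨T, hrT, hT⟩ : ∃ T > r, ∀ x ∈ Ioc r T, A.eval x ≠ 0 := by
    have h1 := Polynomial.eventually_eval_ne_zero hA r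
    have h2 : ∀ᶠ x in 𝓝[>] r, A.eval x ≠ 0 :=
      h1.filter_mono (nhdsWithin_mono r fun x (hx : r < x) => hx.ne')
    obtain ⟨T, hT, h3⟩ := mem_nhdsGT_iff_exists_Ioc_subset.1 h2
    exact ⟨T, hT, h3⟩
  rcases lt_or_gt_of_ne (hT T ⟨hrT, le_rfl⟩) with hs | hs
  · have hpos : ∀ x ∈ Ioc r T, 0 < (-A).eval x := by
      intro x hx
      by_contra! h1
      rw [Polynomial.eval_neg, neg_nonpos] at h1
      obtain ⟨z, hz, hz'⟩ := intermediate_value_Icc' hx.2 A.continuous.continuousOn ⟨hs.le, h1⟩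
      exact hT z ⟨hx.1.trans_le hz.1, hz.2⟩ hz'
    have hf' : ∀ x y, -f (x, y) = (-A).eval x * y + (-B).eval x := fun x y => by
      rw [hf]; simp; ring
    rcases h.neg_left.jac_pos_or_neg with hJ | hJ
    · exact h.neg_left.not_affine_of_pos hJ hf' (by simpa using hr) hrT hpos
    · refine h.neg_left.neg_right.not_affine_of_pos (fun p => ?_) hf' (by simpa using hr) hrT hpos
      have := hJ p
      rw [fderiv_fun_neg (f := g)]
      simp only [neg_apply]
      linarith
  · have hpos : ∀ x ∈ Ioc r T, 0 < A.eval x := by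
      intro x hx
      by_contra! h1
      obtain ⟨z, hz, hz'⟩ := intermediate_value_Icc hx.2 A.continuous.continuousOn ⟨h1, hs.le⟩
      exact hT z ⟨hx.1.trans_le hz.1, hz.2⟩ hz'
    rcases h.jac_pos_or_neg with hJ | hJ
    · exact h.not_affine_of_pos hJ hf hr hrT hpos
    · refine h.neg_right.not_affine_of_pos (fun p => ?_) hf hr hrT hpos
      have := hJ p
      rw [fderiv_fun_neg (f := g)]
      simp only [neg_apply]
      linarith

open Set Filter Topology in
theorem not_square_add_of_pos (h : JacPair f g)
    (hJ : ∀ p, 0 < fderiv ℝ f p (1, 0) * fderiv ℝ g p (0, 1) -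
      fderiv ℝ f p (0, 1) * fderiv ℝ g p (1, 0)) {α r : ℝ} (hα : 0 < α) {q : Polynomial ℝ}
    (hq : ∀ x, 0 < q.derivative.eval x)
    (hf : ∀ x y, f (x, y) = α * (x - r) ^ 2 * y ^ 2 + q.eval x) : False := by
  have hqm : StrictMono fun x => q.eval x := strictMono_of_deriv_pos fun x => by
    rw [Polynomial.deriv]; exact hq x
  have hfy : ∀ x y, fderiv ℝ f (x, y) (0, 1) = α * (x - r) ^ 2 * (2 * y) := fun x y => by
    refine fderiv_snd_eq h.contDiff_left ?_
    simp only [hf]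
    simpa using ((hasDerivAt_pow 2 y).const_mul (α * (x - r) ^ 2)).add_const (q.eval x)
  have hstep : ∀ y > 0, ∀ t ∈ Ico (r - 1) r,
      g (t, y) ≤ g (r - 1, √((α * (t - r) ^ 2 * y ^ 2 + q.eval t - q.eval (r - 1)) / α) / 1) := by
    intro y hy t ht
    have hpos : ∀ s ∈ Icc (r - 1) t,
        0 < (α * (t - r) ^ 2 * y ^ 2 + q.eval t - q.eval s) / α := by
      intro s hs
      have h1 : q.eval s ≤ q.eval t := hqm.monotone hs.2
      have h2 : 0 < (t - r) ^ 2 := by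
        have : t - r ≠ 0 := (sub_neg.2 ht.2).ne
        positivity
      have h3 : 0 < α * (t - r) ^ 2 * y ^ 2 := by positivity
      apply div_pos _ hα
      linarith
    have hsr : ∀ s ∈ Icc (r - 1) t, 0 < r - s := fun s hs => by linarith [hs.2, ht.2]
    have := h.le_of_level hJ
      (Y := fun s => √((α * (t - r) ^ 2 * y ^ 2 + q.eval t - q.eval s) / α) / (r - s))
      (k := α * (t - r) ^ 2 * y ^ 2 + q.eval t) ht.1
      (fun s hs => (((q.differentiableAt).const_sub _).div_const _ |>.sqrt (hpos s hs).ne').div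
        (differentiableAt_id.const_sub r) (hsr s hs).ne')
      (fun s hs => by
        have h1 := (hsr s hs).ne'
        rw [hf, div_pow, Real.sq_sqrt (hpos s hs).le]
        field_simp
        ring)
      (fun s hs => by
        have h1 := hsr s hs
        have h2 := Real.sqrt_pos.2 (hpos s hs)
        rw [hfy]
        have h3 : (s - r) ≠ 0 := by linarith
        positivity)
    have e : √((α * (t - r) ^ 2 * y ^ 2 + q.eval t - q.eval t) / α) / (r - t) = y := by
      have h1 := hsr t ⟨ht.1, le_rfl⟩
      have : (α * (t - r) ^ 2 * y ^ 2 + q.eval t - q.eval t) / α = ((r - t) * y) ^ 2 := by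
        field_simp
        ring
      rw [this, Real.sqrt_sq (by positivity)]
      field_simp
    rw [e] at this
    simpa using this
  have hlim : ∀ y > 0, g (r, y) ≤ g (r - 1, √((q.eval r - q.eval (r - 1)) / α)) := by
    intro y hy
    have c1 : Continuous fun t =>
        g (r - 1, √((α * (t - r) ^ 2 * y ^ 2 + q.eval t - q.eval (r - 1)) / α) / 1) := by
      have := h.contDiff_right.continuous
      have := q.continuous
      fun_prop
    have c2 : Continuous fun t => g (t, y) := by
      have := h.contDiff_right.continuous
      fun_prop
    have t1 := (c1.tendsto r).mono_left (nhdsWithin_le_nhds (s := Iio r))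
    have t2 := (c2.tendsto r).mono_left (nhdsWithin_le_nhds (s := Iio r))
    simp only [sub_self, zero_pow two_ne_zero, mul_zero, zero_mul, zero_add, div_one] at t1
    refine le_of_tendsto_of_tendsto t2 t1 ?_
    filter_upwards [Ico_mem_nhdsLT (show r - 1 < r by linarith)] with t ht
    simpa using hstep y hy t ht
  have hmono : Monotone fun y => g (r, y) := by
    have hd : ∀ y, HasDerivAt (fun y => g (r, y)) (fderiv ℝ g (r, y) (0, 1)) y := fun y => by
      simpa using h.contDiff_right.hasDerivAt_curve (hasDerivAt_const y r) (hasDerivAt_id y)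
    refine monotone_of_deriv_nonneg (fun y => (hd y).differentiableAt) fun y => ?_
    rw [(hd y).deriv]
    have h1 := hJ (r, y)
    have h2 : fderiv ℝ f (r, y) (1, 0) = q.derivative.eval r := by
      refine fderiv_fst_eq h.contDiff_left ?_
      simp only [hf]
      have := ((((hasDerivAt_id r).sub_const r).pow 2).const_mul α |>.mul_const (y ^ 2)).add
        (q.hasDerivAt r)
      exact this.congr_deriv (by simp)
    rw [hfy, h2] at h1
    simp only [sub_self, zero_pow two_ne_zero, mul_zero, zero_mul, sub_zero] at h1
    exact (pos_of_mul_pos_right h1 (hq r).le).le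
  obtain ⟨y, hy⟩ := h.surjective_vertical (r := r) (fun y => by rw [hfy]; simp)
    (g (r - 1, √((q.eval r - q.eval (r - 1)) / α)) + 1)
  simp only at hy
  have h1 := hmono (le_max_left y 1)
  have h2 := hlim (max y 1) (by positivity)
  simp only at h1
  linarith

/-- The first component of a Jacobian pair is not of the form `α (x - r)² y² + q(x)`. -/
theorem not_square_add (h : JacPair f g) {α r : ℝ} (hα : α ≠ 0) {q : Polynomial ℝ}
    (hf : ∀ x y, f (x, y) = α * (x - r) ^ 2 * y ^ 2 + q.eval x) : False := by
  wlog hαpos : 0 < α generalizing f α q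
  · refine this h.neg_left (α := -α) (q := -q) (neg_ne_zero.2 hα) (fun x y => ?_) ?_
    · rw [hf]; simp; ring
    · have := lt_of_le_of_ne (not_lt.1 hαpos) hα
      linarith
  have hcrit : ∀ x, q.derivative.eval x ≠ 0 := by
    intro x hx
    apply h.not_critical (x := x) (y := 0)
    · simp only [hf]
      simpa [hx] using q.hasDerivAt x
    · simp only [hf]
      simpa using ((hasDerivAt_pow 2 (0 : ℝ)).const_mul (α * (x - r) ^ 2)).add_const (q.eval x)
  wlog hq : 0 < q.derivative.eval 0 generalizing f g q r
  · refine this h.reflect (r := -r) (q := q.comp (-Polynomial.X)) (fun x y => ?_) (fun x => ?_) ?_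
    · simp only [hf, Polynomial.eval_comp, Polynomial.eval_neg, Polynomial.eval_X]
      ring
    · simpa [Polynomial.derivative_comp] using hcrit (-x)
    · have := lt_of_le_of_ne (not_lt.1 hq) (hcrit 0)
      simpa [Polynomial.derivative_comp] using this
  have hqpos : ∀ x, 0 < q.derivative.eval x := by
    intro x
    by_contra! hx
    obtain ⟨z, hz⟩ := mem_range_of_exists_le_of_exists_ge q.derivative.continuous ⟨x, hx⟩
      ⟨0, hq.le⟩
    exact hcrit z hz
  rcases h.jac_pos_or_neg with hJ | hJ
  · exact h.not_square_add_of_pos hJ hαpos hqpos hf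
  · refine h.neg_right.not_square_add_of_pos (fun p => ?_) hαpos hqpos hf
    have := hJ p
    rw [fderiv_fun_neg (f := g)]
    simp only [neg_apply]
    linarith

end JacPair

namespace Polynomial

/-- `p` has degree at most `n`, and its coefficient in degree `n` is `c`. -/
def TopCoeff (p : Polynomial ℝ) (n : ℕ) (c : ℝ) : Prop :=
  p.natDegree ≤ n ∧ p.coeff n = c

namespace TopCoeff

variable {p q : Polynomial ℝ} {m n : ℕ} {a b : ℝ}

theorem mk (h : p.natDegree ≤ n) : p.TopCoeff n (p.coeff n) :=
  ⟨h, rfl⟩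

theorem congr (h : p.TopCoeff n a) (e : a = b) : p.TopCoeff n b := e ▸ h

theorem const (c : ℝ) : (C c).TopCoeff 0 c := ⟨by simp, by simp⟩

theorem X_sub (r : ℝ) : (X - C r).TopCoeff 1 1 := ⟨by simp, by simp⟩

theorem add (hp : p.TopCoeff n a) (hq : q.TopCoeff n b) : (p + q).TopCoeff n (a + b) :=
  ⟨natDegree_add_le_of_degree_le hp.1 hq.1, by rw [coeff_add, hp.2, hq.2]⟩

theorem neg (hp : p.TopCoeff n a) : (-p).TopCoeff n (-a) :=
  ⟨by rw [natDegree_neg]; exact hp.1, by rw [coeff_neg, hp.2]⟩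

theorem sub (hp : p.TopCoeff n a) (hq : q.TopCoeff n b) : (p - q).TopCoeff n (a - b) := by
  rw [sub_eq_add_neg, sub_eq_add_neg]; exact hp.add hq.neg

theorem mul (hp : p.TopCoeff m a) (hq : q.TopCoeff n b) : (p * q).TopCoeff (m + n) (a * b) :=
  ⟨natDegree_mul_le_of_le hp.1 hq.1, by
    rw [coeff_mul_add_eq_of_natDegree_le hp.1 hq.1, hp.2, hq.2]⟩

theorem pow (hp : p.TopCoeff n a) (k : ℕ) : (p ^ k).TopCoeff (k * n) (a ^ k) :=
  ⟨natDegree_pow_le_of_le k hp.1, by rw [coeff_pow_of_natDegree_le hp.1, hp.2]⟩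

theorem weaken (hp : p.TopCoeff m a) (hmn : m < n) : p.TopCoeff n 0 :=
  ⟨hp.1.trans hmn.le, coeff_eq_zero_of_natDegree_lt (hp.1.trans_lt hmn)⟩

theorem derivative (hp : p.TopCoeff (n + 1) a) : p.derivative.TopCoeff n ((n + 1) * a) :=
  ⟨(natDegree_derivative_le p).trans (by have := hp.1; omega), by
    rw [coeff_derivative, hp.2, mul_comm]⟩

theorem natDegree_eq (hp : p.TopCoeff n a) (ha : a ≠ 0) : p.natDegree = n :=
  natDegree_eq_of_le_of_coeff_ne_zero hp.1 (by rw [hp.2]; exact ha)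

theorem leadingCoeff_eq (hp : p.TopCoeff n a) (ha : a ≠ 0) : p.leadingCoeff = a := by
  rw [leadingCoeff, hp.natDegree_eq ha, hp.2]

end TopCoeff

variable {f g : ℝ × ℝ → ℝ} {a₀ a₁ a₂ : Polynomial ℝ}

theorem _root_.JacPair.not_cubic_of_linear (h : JacPair f g) {α r c : ℝ} (hα : α ≠ 0)
    (hf : ∀ x y, f (x, y) = α * (x - r) * y ^ 3 + a₂.eval x * y ^ 2 + a₁.eval x * y + a₀.eval x)
    (h₂ : a₂.natDegree ≤ 2) (h₁ : a₁.natDegree ≤ 3) (h₀ : a₀.TopCoeff 5 c) (hc : c ≠ 0) :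
    False := by
  have hcrit : ∀ x y, 3 * (α * (x - r)) * y ^ 2 + 2 * a₂.eval x * y + a₁.eval x = 0 →
      α * y ^ 3 + a₂.derivative.eval x * y ^ 2 + a₁.derivative.eval x * y +
        a₀.derivative.eval x ≠ 0 := by
    intro x y hy hx
    refine h.not_critical_cubic (a₃ := C α * (X - C r)) (a₂ := a₂) (a₁ := a₁) (a₀ := a₀) (x := x)
      (y := y) (fun x y => by simp [hf]) ?_ (by simpa using hy)
    simpa using hx
  set p₀ := C 2 * a₂ * a₁
  set p₁ := -(C 3 * a₂.derivative * a₁)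
  set p₂ := C (9 * α) * a₀.derivative
  set q₀ := C 4 * a₂ ^ 2
  set q₁ := -(C (3 * α) * a₁ + C 6 * a₂ * a₂.derivative)
  set q₂ := C (9 * α) * a₁.derivative
  set l := X - C r
  set S := C (6 * α) * p₀ * p₁ - C 2 * a₂ * (p₀ * q₂ + p₁ * q₁ + p₂ * q₀) +
    a₁ * (q₁ ^ 2 + C 2 * q₀ * q₂) + l * (C (3 * α) * (p₁ ^ 2 + C 2 * p₀ * p₂) -
    C 2 * a₂ * (p₁ * q₂ + p₂ * q₁) + C 2 * a₁ * q₁ * q₂) + l ^ 2 * (C (6 * α) * p₁ * p₂ -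
    C 2 * a₂ * p₂ * q₂ + a₁ * q₂ ^ 2) + l ^ 3 * (C (3 * α) * p₂ ^ 2) with hS
  set P := p₀ + l * p₁ + l ^ 2 * p₂ with hP
  set Q := q₀ + l * q₁ + l ^ 2 * q₂ with hQ
  have hfac : C (3 * α) * l * P ^ 2 - C 2 * a₂ * P * Q + a₁ * Q ^ 2 = l ^ 2 * S := by
    simp only [hP, hQ, hS, p₀, p₁, p₂, q₀, q₁, q₂, C_mul, map_ofNat]
    ring
  have t₂ := TopCoeff.mk h₂
  have t₁ := TopCoeff.mk h₁
  have e₂ := t₂.derivative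
  have e₁ := t₁.derivative
  have e₀ := h₀.derivative
  have tl : l.TopCoeff 1 1 := TopCoeff.X_sub r
  have tp₂ : p₂.TopCoeff 4 _ := (TopCoeff.const _).mul e₀
  have tq₂ : q₂.TopCoeff 2 _ := (TopCoeff.const _).mul e₁
  have tp₁ : p₁.TopCoeff 4 _ := (((TopCoeff.const _).mul e₂).mul t₁).neg
  have tp₀ : p₀.TopCoeff 5 _ := ((TopCoeff.const _).mul t₂).mul t₁
  have tq₀ : q₀.TopCoeff 4 _ := (TopCoeff.const _).mul (t₂.pow 2)
  have tq₁ : q₁.TopCoeff 3 _ := (((TopCoeff.const _).mul t₁).add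
    (((TopCoeff.const _).mul t₂).mul e₂)).neg
  have tP : P.TopCoeff 6 (45 * α * c) := by
    refine (((tp₀.weaken (by norm_num)).add ((tl.mul tp₁).weaken (by norm_num))).add
      ((tl.pow 2).mul tp₂)).congr ?_
    norm_num
    ring
  have tQ : Q.TopCoeff 4 _ := (tq₀.add (tl.mul tq₁)).add ((tl.pow 2).mul tq₂)
  have tR : (C (3 * α) * l * P ^ 2 - C 2 * a₂ * P * Q + a₁ * Q ^ 2).TopCoeff 13
      (6075 * α ^ 3 * c ^ 2) := by
    refine (((((TopCoeff.const _).mul tl).mul (tP.pow 2)).sub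
      (((((TopCoeff.const _).mul t₂).mul tP).mul tQ).weaken (by norm_num))).add
      ((t₁.mul (tQ.pow 2)).weaken (by norm_num))).congr ?_
    ring
  have hodd : Odd (C (3 * α) * l * P ^ 2 - C 2 * a₂ * P * Q + a₁ * Q ^ 2).natDegree := by
    rw [tR.natDegree_eq (by positivity)]
    decide
  have hR0 : C (3 * α) * l * P ^ 2 - C 2 * a₂ * P * Q + a₁ * Q ^ 2 ≠ 0 :=
    ne_zero_of_natDegree_gt hodd.pos
  have hSr : S.eval r ≠ 0 := by
    have key : S.eval r = 9 * α * (α * a₁.eval r ^ 3 -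
        2 * a₂.eval r * a₂.derivative.eval r * a₁.eval r ^ 2 +
        4 * a₂.eval r ^ 2 * a₁.derivative.eval r * a₁.eval r -
        8 * a₂.eval r ^ 3 * a₀.derivative.eval r) := by
      simp [hS, p₀, p₁, p₂, q₀, q₁, q₂, l]
      ring
    rw [key]
    refine mul_ne_zero (by positivity) fun h0 => ?_
    by_cases hb : a₂.eval r = 0
    · have hb1 : a₁.eval r = 0 := by simpa [hb, hα] using h0
      have hdeg : (C α * X ^ 3 + C (a₂.derivative.eval r) * X ^ 2 +
        C (a₁.derivative.eval r) * X + C (a₀.derivative.eval r)).natDegree = 3 :=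
        natDegree_cubic hα
      obtain ⟨y, hy⟩ := surjective_eval_of_odd_natDegree (by rw [hdeg]; decide) 0
      exact hcrit r y (by simp [hb, hb1]) (by simpa using hy)
    · refine hcrit r (-(a₁.eval r) / (2 * a₂.eval r)) (by field_simp; ring) ?_
      field_simp
      linear_combination -h0
  obtain ⟨x, hx, hy⟩ := exists_common_zero_of_odd_natDegree hodd
  have hxr : x ≠ r := by
    rintro rfl
    rw [hfac] at hx hR0
    rw [rootMultiplicity_mul hR0, rootMultiplicity_eq_zero (p := S) hSr,
      show l = X - C x from rfl, rootMultiplicity_X_sub_C_pow] at hx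
    exact absurd hx (by decide)
  have hl : l.eval x ≠ 0 := by simpa [l, sub_eq_zero] using hxr
  obtain ⟨y, hy1, hy2⟩ := hy (by simpa [hα] using hl)
  simp [l, hP, hQ, p₀, p₁, p₂, q₀, q₁, q₂] at hl hy1 hy2
  refine hcrit x y (by linear_combination hy2) ?_
  have h9 : 9 * α * (x - r) ^ 2 ≠ 0 := by positivity
  apply mul_left_cancel₀ h9
  linear_combination hy1 + (3 * α * (x - r) * y + 3 * (x - r) * a₂.derivative.eval x -
    2 * a₂.eval x) * hy2

theorem _root_.JacPair.not_cubic_of_const (h : JacPair f g) {β γ c : ℝ} (hβ : β ≠ 0) (hγ : γ ≠ 0)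
    (hf : ∀ x y, f (x, y) = β * y ^ 3 + a₂.eval x * y ^ 2 + a₁.eval x * y + a₀.eval x)
    (h₂ : a₂.TopCoeff 2 γ) (h₁ : a₁.natDegree ≤ 3) (h₀ : a₀.TopCoeff 5 c) (hc : c ≠ 0) :
    False := by
  set P := C (3 * β) * a₀.derivative - a₂.derivative * a₁ with hP
  set Q := C (3 * β) * a₁.derivative - C 2 * a₂.derivative * a₂ with hQ
  have t₁ := TopCoeff.mk h₁
  have e₂ := h₂.derivative
  have e₁ := t₁.derivative
  have e₀ := h₀.derivative
  have tP : P.TopCoeff 4 _ := ((TopCoeff.const _).mul e₀).sub (e₂.mul t₁)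
  have tQ : Q.TopCoeff 3 _ := (((TopCoeff.const _).mul e₁).weaken (by norm_num)).sub
    (((TopCoeff.const _).mul e₂).mul h₂)
  have tR : (C (3 * β) * P ^ 2 - C 2 * a₂ * P * Q + a₁ * Q ^ 2).TopCoeff 9
      (120 * β * γ ^ 3 * c) := by
    refine (((((TopCoeff.const _).mul (tP.pow 2)).weaken (by norm_num)).sub
      ((((TopCoeff.const _).mul h₂).mul tP).mul tQ)).add (t₁.mul (tQ.pow 2))).congr ?_
    norm_num
    ring
  have hodd : Odd (C (3 * β) * P ^ 2 - C 2 * a₂ * P * Q + a₁ * Q ^ 2).natDegree := by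
    rw [tR.natDegree_eq (by positivity)]
    decide
  obtain ⟨x, -, hy⟩ := exists_common_zero_of_odd_natDegree hodd
  obtain ⟨y, hy1, hy2⟩ := hy (by simpa using hβ)
  simp [hP, hQ] at hy1 hy2
  refine h.not_critical_cubic (a₃ := C β) (a₂ := a₂) (a₁ := a₁) (a₀ := a₀) (x := x)
    (y := y) (fun x y => by simp [hf]) ?_ (by simpa [mul_assoc] using hy2)
  simp only [derivative_C, eval_zero, zero_mul, zero_add]
  have h3 : 3 * β ≠ 0 := by positivity
  apply mul_left_cancel₀ h3
  linear_combination hy1 + a₂.derivative.eval x * hy2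

theorem _root_.JacPair.not_critical_quadratic (h : JacPair f g)
    (hf : ∀ x y, f (x, y) = a₂.eval x * y ^ 2 + a₁.eval x * y + a₀.eval x) {x y : ℝ}
    (hy : 2 * a₂.eval x * y + a₁.eval x = 0) :
    a₂.derivative.eval x * y ^ 2 + a₁.derivative.eval x * y + a₀.derivative.eval x ≠ 0 := by
  intro hx
  exact h.not_critical_cubic (a₃ := 0) (a₂ := a₂) (a₁ := a₁) (a₀ := a₀) (x := x) (y := y)
    (fun x y => by simp [hf]) (by simpa using hx) (by simpa using hy)

/-- Away from the zeros of the leading coefficient of a quadratic, the derivative of its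
critical value does not vanish. -/
theorem _root_.JacPair.critical_value_deriv_ne_zero (h : JacPair f g)
    (hf : ∀ x y, f (x, y) = a₂.eval x * y ^ 2 + a₁.eval x * y + a₀.eval x) {x : ℝ}
    (hx : a₂.eval x ≠ 0) :
    (C 4 * a₀.derivative * a₂ ^ 2 - C 2 * a₁.derivative * a₁ * a₂ +
      a₂.derivative * a₁ ^ 2).eval x ≠ 0 := by
  intro h0
  refine h.not_critical_quadratic hf (x := x) (y := -(a₁.eval x) / (2 * a₂.eval x))
    (by field_simp; ring) ?_
  simp at h0
  field_simp
  linear_combination h0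

end Polynomial

open Set Filter Topology in
theorem eq_of_hasDerivAt_pos_of_eq {φ φ' : ℝ → ℝ} {k : ℝ} (hφ : ∀ x, HasDerivAt φ (φ' x) x)
    (hpos : ∀ x, φ x = k → 0 < φ' x) {a b : ℝ} (ha : φ a = k) (hb : φ b = k) : a = b := by
  wlog hab : a < b generalizing a b
  · rcases lt_trichotomy a b with h | h | h
    · exact absurd h hab
    · exact h
    · exact (this hb ha h).symm
  have hcont : Continuous φ := continuous_iff_continuousAt.2 fun x => (hφ x).continuousAt
  have hsign : ∀ x, φ x = k → ∀ᶠ t in 𝓝[≠] x, 0 < (t - x) * (φ t - k) := by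
    intro x hx
    filter_upwards [(hasDerivAt_iff_tendsto_slope.1 (hφ x)).eventually (lt_mem_nhds (hpos x hx)),
      self_mem_nhdsWithin] with t ht htx
    rw [slope_def_field, hx] at ht
    have h0 : t - x ≠ 0 := sub_ne_zero.2 htx
    have : (t - x) * (φ t - k) = (φ t - k) / (t - x) * (t - x) ^ 2 := by field_simp
    rw [this]
    positivity
  obtain ⟨u, hau, hu⟩ := mem_nhdsGT_iff_exists_Ioo_subset.1
    ((nhdsGT_le_nhdsNE a) (hsign a ha))
  have hau' : a < u := hau
  obtain ⟨c, hc, hcl⟩ := ((isCompact_Icc (a := a) (b := b)).inter_right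
    ((isClosed_le hcont continuous_const).inter (isClosed_le continuous_const continuous_id) :
      IsClosed {t | φ t ≤ k ∧ min u b ≤ t})).exists_isLeast
      ⟨b, right_mem_Icc.2 hab.le, hb.le, (min_le_right u b : min u b ≤ b)⟩
  have hac : a < c := (lt_min hau' hab).trans_le hc.2.2
  have hlt : ∀ t ∈ Ioo a c, k < φ t := by
    intro t ht
    by_contra! hcon
    rcases lt_or_ge t (min u b) with h | h
    · have := hu ⟨ht.1, h.trans_le (min_le_left _ _)⟩
      have h1 : 0 < (t - a) * (φ t - k) := this
      have h2 := (pos_iff_pos_of_mul_pos h1).1 (sub_pos.2 ht.1)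
      linarith
    · exact absurd (hcl ⟨⟨ht.1.le, ht.2.le.trans hc.1.2⟩, hcon, h⟩) (not_le.2 ht.2)
  have hmem : Ioo a c ∈ 𝓝[<] c := Ioo_mem_nhdsLT hac
  have hck : φ c = k := by
    refine le_antisymm hc.2.1 (ge_of_tendsto (hcont.continuousAt.tendsto.mono_left
      (nhdsWithin_le_nhds (s := Iio c))) ?_)
    filter_upwards [hmem] with t ht using (hlt t ht).le
  obtain ⟨t, ht1, ht2⟩ := (((hsign c hck).filter_mono (nhdsLT_le_nhdsNE c)).and hmem).exists
  have h1 : 0 < (t - c) * (φ t - k) := ht1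
  have := (pos_iff_pos_of_mul_pos h1).2 (sub_pos.2 (hlt t ht2))
  linarith [ht2.2]

namespace JacPair

variable {f g : ℝ × ℝ → ℝ}

theorem injective_of_levels (h : JacPair f g) (G : ℝ × ℝ ≃ₜ ℝ × ℝ)
    (huniq : ∀ k, ∃ R, ∀ y, R ≤ |y| → ∀ x x', f (G (x, y)) = k → f (G (x', y)) = k → x = x')
    (hcoer : ∀ k M, ∃ B, ∀ x y, |y| ≤ M →
      (B ≤ x → k < f (G (x, y))) ∧ (x ≤ -B → f (G (x, y)) < k)) :
    Function.Injective fun p => (f p, g p) := by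
  have h1 := (h.isLocalHomeomorph.comp G.isLocalHomeomorph).injective_of_levels huniq hcoer
  intro p q hpq
  have := @h1 (G.symm p) (G.symm q) (by simpa using hpq)
  exact G.symm.injective this

theorem injective_of_derivative (h : JacPair f g) {f' : ℝ → ℝ → ℝ}
    (hd : ∀ x y, HasDerivAt (fun x => f (x, y)) (f' x y) x)
    (hlev : ∀ k, ∃ R, ∀ x y, f (x, y) = k → f' x y ≤ 0 → |y| < R)
    (hcoer : ∀ k M, ∃ B, ∀ x y, |y| ≤ M → (B ≤ x → k < f (x, y)) ∧ (x ≤ -B → f (x, y) < k)) :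
    Function.Injective fun p => (f p, g p) := by
  refine h.injective_of_levels (Homeomorph.refl _) (fun k => ?_) hcoer
  obtain ⟨R, hR⟩ := hlev k
  refine ⟨R, fun y hy x x' hx hx' => ?_⟩
  refine eq_of_hasDerivAt_pos_of_eq (fun x => hd x y) (fun x hx => ?_) hx hx'
  by_contra! hcon
  exact absurd (hR x y hx hcon) (not_lt.2 hy)

end JacPair

namespace Polynomial

theorem exists_abs_eval_le {p : Polynomial ℝ} {n : ℕ} (hp : p.natDegree ≤ n) :
    ∃ K, 0 ≤ K ∧ ∀ x, |p.eval x| ≤ K * (1 + |x|) ^ n := by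
  refine ⟨∑ i ∈ Finset.range (n + 1), |p.coeff i|, Finset.sum_nonneg fun _ _ => abs_nonneg _,
    fun x => ?_⟩
  rw [eval_eq_sum_range' (Nat.lt_succ_of_le hp), Finset.sum_mul]
  refine (Finset.abs_sum_le_sum_abs _ _).trans (Finset.sum_le_sum fun i hi => ?_)
  rw [abs_mul, abs_pow]
  gcongr
  have h1 : i ≤ n := Nat.lt_succ_iff.1 (Finset.mem_range.1 hi)
  calc |x| ^ i ≤ (1 + |x|) ^ i := by gcongr; linarith
    _ ≤ (1 + |x|) ^ n := pow_le_pow_right₀ (by linarith [abs_nonneg x]) h1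

variable {f g : ℝ × ℝ → ℝ} {a₀ a₁ a₂ a₃ a₄ : Polynomial ℝ}

theorem hasDerivAt_eval_quartic (y x : ℝ)
    (hf : ∀ x y, f (x, y) = a₄.eval x * y ^ 4 + a₃.eval x * y ^ 3 + a₂.eval x * y ^ 2 +
      a₁.eval x * y + a₀.eval x) :
    HasDerivAt (fun x => f (x, y)) (a₄.derivative.eval x * y ^ 4 + a₃.derivative.eval x * y ^ 3 +
      a₂.derivative.eval x * y ^ 2 + a₁.derivative.eval x * y + a₀.derivative.eval x) x := by
  simp only [hf]
  exact (((((a₄.hasDerivAt x).mul_const _).add ((a₃.hasDerivAt x).mul_const _)).add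
    ((a₂.hasDerivAt x).mul_const _)).add ((a₁.hasDerivAt x).mul_const _)).add (a₀.hasDerivAt x)

theorem exists_coercive_of_natDegree_le
    (hf : ∀ x y, f (x, y) = a₄.eval x * y ^ 4 + a₃.eval x * y ^ 3 + a₂.eval x * y ^ 2 +
      a₁.eval x * y + a₀.eval x) (h₄ : a₄.natDegree ≤ 4)
    (h₃ : a₃.natDegree ≤ 4) (h₂ : a₂.natDegree ≤ 4) (h₁ : a₁.natDegree ≤ 4)
    (h₀ : (a₀ - X ^ 5).natDegree ≤ 4) (k M : ℝ) :
    ∃ B, ∀ x y, |y| ≤ M → (B ≤ x → k < f (x, y)) ∧ (x ≤ -B → f (x, y) < k) := by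
  obtain ⟨K₄, hK₄, e₄⟩ := exists_abs_eval_le h₄
  obtain ⟨K₃, hK₃, e₃⟩ := exists_abs_eval_le h₃
  obtain ⟨K₂, hK₂, e₂⟩ := exists_abs_eval_le h₂
  obtain ⟨K₁, hK₁, e₁⟩ := exists_abs_eval_le h₁
  obtain ⟨K₀, hK₀, e₀⟩ := exists_abs_eval_le h₀
  set N := |M| with hN
  have hN0 : 0 ≤ N := abs_nonneg M
  set K := K₄ * N ^ 4 + K₃ * N ^ 3 + K₂ * N ^ 2 + K₁ * N + K₀ with hK
  have hK0 : 0 ≤ K := by positivity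
  have hbound : ∀ x y, |y| ≤ M → |f (x, y) - x ^ 5| ≤ K * (1 + |x|) ^ 4 := by
    intro x y hy
    have hyN : |y| ≤ N := hy.trans (le_abs_self M)
    have hfx : f (x, y) - x ^ 5 = a₄.eval x * y ^ 4 + a₃.eval x * y ^ 3 + a₂.eval x * y ^ 2 +
      a₁.eval x * y + (a₀ - X ^ 5).eval x := by simp [hf]; ring
    have hmono : ∀ (n : ℕ) (p : Polynomial ℝ) (L : ℝ), |p.eval x| ≤ L * (1 + |x|) ^ 4 →
        |p.eval x * y ^ n| ≤ L * (1 + |x|) ^ 4 * N ^ n := by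
      intro n p L hL
      rw [abs_mul, abs_pow]
      exact mul_le_mul hL (pow_le_pow_left₀ (abs_nonneg y) hyN n) (by positivity)
        ((abs_nonneg _).trans hL)
    have m₄ := hmono 4 _ _ (e₄ x)
    have m₃ := hmono 3 _ _ (e₃ x)
    have m₂ := hmono 2 _ _ (e₂ x)
    have m₁ := hmono 1 _ _ (e₁ x)
    have m₀ := e₀ x
    rw [pow_one] at m₁
    rw [hfx, hK]
    rw [abs_le] at *
    constructor <;> linarith
  refine ⟨16 * K + |k| + 1, fun x y hy => ⟨fun hx => ?_, fun hx => ?_⟩⟩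
  · have hx1 : 1 ≤ x := by linarith [abs_nonneg k]
    have h1 := (abs_le.1 (hbound x y hy)).1
    rw [abs_of_nonneg (by linarith : (0 : ℝ) ≤ x)] at h1
    have h2 : (1 + x) ^ 4 ≤ (2 * x) ^ 4 := by gcongr; linarith
    have h3 : K * (1 + x) ^ 4 ≤ K * (2 * x) ^ 4 := by gcongr
    have h4 : 0 ≤ (x - (16 * K + |k| + 1)) * x ^ 4 :=
      mul_nonneg (by linarith) (by positivity)
    have h5 : 1 ≤ x ^ 4 := one_le_pow₀ hx1
    nlinarith [le_abs_self k, abs_nonneg k]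
  · have hx1 : 1 ≤ -x := by linarith [abs_nonneg k]
    have h1 := (abs_le.1 (hbound x y hy)).2
    rw [abs_of_nonpos (by linarith : x ≤ 0)] at h1
    have h2 : (1 + -x) ^ 4 ≤ (2 * -x) ^ 4 := by gcongr; linarith
    have h3 : K * (1 + -x) ^ 4 ≤ K * (2 * -x) ^ 4 := by gcongr
    have h4 : 0 ≤ (-x - (16 * K + |k| + 1)) * (-x) ^ 4 :=
      mul_nonneg (by linarith) (by positivity)
    have h5 : 1 ≤ (-x) ^ 4 := one_le_pow₀ hx1
    nlinarith [neg_abs_le k, abs_nonneg k]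

theorem bounded_of_quartic_estimates {K m w : ℝ} (hK : 0 ≤ K) (hm : 1 ≤ m) (hw : 1 ≤ w)
    (h1 : m ^ 4 ≤ K * (w ^ 3 + m * w ^ 2 + m ^ 2 * w + m ^ 3))
    (h2 : w ^ 4 ≤ K * (m * w ^ 3 + m ^ 2 * w ^ 2 + m ^ 3 * w + m ^ 5)) :
    w ≤ max (4 * K) (K * (3 + 4 * K) * (4 * K * (K * (3 + 4 * K)) ^ 3)) := by
  have hm0 : 0 < m := by linarith
  have hw0 : 0 < w := by linarith
  rcases le_or_gt w m with h | h
  · refine le_max_of_le_left (h.trans ?_)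
    have h3 : w ^ 3 + m * w ^ 2 + m ^ 2 * w + m ^ 3 ≤
        m ^ 3 + m * m ^ 2 + m ^ 2 * m + m ^ 3 := by gcongr
    have h4 : m * m ^ 3 ≤ 4 * K * m ^ 3 := by
      nlinarith [mul_le_mul_of_nonneg_left h3 hK]
    exact le_of_mul_le_mul_right h4 (by positivity)
  · refine le_max_of_le_right ?_
    have h3 : w ^ 3 + m * w ^ 2 + m ^ 2 * w + m ^ 3 ≤
        w ^ 3 + w * w ^ 2 + w ^ 2 * w + w ^ 3 := by gcongr
    have h4 : m ^ 4 ≤ 4 * K * w ^ 3 := by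
      nlinarith [mul_le_mul_of_nonneg_left h3 hK]
    have h5 : m * w ^ 3 + m ^ 2 * w ^ 2 + m ^ 3 * w + m ^ 5 ≤ m * w ^ 3 * (3 + 4 * K) := by
      have e1 : m * (m * w ^ 2) ≤ m * (w * w ^ 2) := by gcongr
      have e2 : m * (m ^ 2 * w) ≤ m * (w ^ 2 * w) := by gcongr
      have e3 : m * m ^ 4 ≤ m * (4 * K * w ^ 3) := by gcongr
      nlinarith
    have h6 : w * w ^ 3 ≤ K * (3 + 4 * K) * m * w ^ 3 := by
      nlinarith [mul_le_mul_of_nonneg_left h5 hK]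
    have h7 : w ≤ K * (3 + 4 * K) * m := le_of_mul_le_mul_right h6 (by positivity)
    have h8 : m * m ^ 3 ≤ 4 * K * (K * (3 + 4 * K)) ^ 3 * m ^ 3 := by
      have : w ^ 3 ≤ (K * (3 + 4 * K) * m) ^ 3 := by gcongr
      calc m * m ^ 3 = m ^ 4 := by ring
        _ ≤ 4 * K * w ^ 3 := h4
        _ ≤ 4 * K * (K * (3 + 4 * K) * m) ^ 3 := by gcongr
        _ = _ := by ring
    have h9 := le_of_mul_le_mul_right h8 (by positivity)
    exact h7.trans (by gcongr)

theorem bounded_of_cubic_estimates {K m w : ℝ} (hK : 1 ≤ K) (hm : 1 ≤ m) (hw : 1 ≤ w)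
    (h1 : m ^ 4 ≤ K * (w ^ 2 + m ^ 2 * w + m ^ 3))
    (h2 : w ^ 3 ≤ K * (m * w ^ 2 + m ^ 3 * w + m ^ 5)) :
    w ≤ max ((2 * K) ^ 2) (K * (1 + 4 * K + 16 * K ^ 2) * (4 * K * (K * (1 + 4 * K + 16 * K ^ 2)))) := by
  have hm0 : 0 < m := by linarith
  have hw0 : 0 < w := by linarith
  have hK0 : 0 < K := by linarith
  rcases le_or_gt (4 * K * w) (m ^ 2) with h | h
  · refine le_max_of_le_left ?_
    have e1 : K * w ≤ m ^ 2 / 4 := by linarith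
    have e2 : K * w ^ 2 ≤ m ^ 4 / 4 := by
      have : w ≤ m ^ 2 := by nlinarith
      nlinarith
    have e3 : K * (m ^ 2 * w) ≤ m ^ 4 / 4 := by nlinarith [sq_nonneg m]
    have h3 : m * m ^ 3 ≤ 2 * K * m ^ 3 := by nlinarith
    have h4 : m ≤ 2 * K := le_of_mul_le_mul_right h3 (by positivity)
    have : w ≤ m ^ 2 := by nlinarith
    exact this.trans (by gcongr)
  · refine le_max_of_le_right ?_
    have h5 : m * w ^ 2 + m ^ 3 * w + m ^ 5 ≤ m * w ^ 2 * (1 + 4 * K + 16 * K ^ 2) := by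
      have e2 : m * w * m ^ 2 ≤ m * w * (4 * K * w) := by gcongr
      have e3 : m * (m ^ 2) ^ 2 ≤ m * (4 * K * w) ^ 2 := by gcongr
      nlinarith
    have h6 : w * w ^ 2 ≤ K * (1 + 4 * K + 16 * K ^ 2) * m * w ^ 2 := by
      nlinarith [mul_le_mul_of_nonneg_left h5 hK0.le]
    have h7 : w ≤ K * (1 + 4 * K + 16 * K ^ 2) * m := le_of_mul_le_mul_right h6 (by positivity)
    have h8 : m * m ≤ 4 * K * (K * (1 + 4 * K + 16 * K ^ 2)) * m := by
      nlinarith [mul_le_mul_of_nonneg_left h7 hK0.le]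
    have h9 := le_of_mul_le_mul_right h8 hm0
    exact h7.trans (by gcongr)

end Polynomial

namespace Polynomial

variable {f g : ℝ × ℝ → ℝ} {a₀ a₁ a₂ a₃ a₄ : Polynomial ℝ}

theorem exists_abs_eval_mul_pow_le {p : Polynomial ℝ} {i : ℕ} (hp : p.natDegree ≤ i) (n : ℕ) :
    ∃ K, 0 ≤ K ∧ ∀ x y, |p.eval x * y ^ n| ≤ K * ((1 + |x|) ^ i * (1 + |y|) ^ n) := by
  obtain ⟨K, hK, h⟩ := exists_abs_eval_le hp
  refine ⟨K, hK, fun x y => ?_⟩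
  rw [abs_mul, abs_pow, ← mul_assoc]
  exact mul_le_mul (h x) (pow_le_pow_left₀ (abs_nonneg y) (by linarith) n) (by positivity)
    (by positivity)

theorem exists_abs_add_le {φ ψ Φ Ψ : ℝ → ℝ → ℝ} (hΦ : ∀ x y, 0 ≤ Φ x y) (hΨ : ∀ x y, 0 ≤ Ψ x y)
    (h₁ : ∃ K, 0 ≤ K ∧ ∀ x y, |φ x y| ≤ K * Φ x y) (h₂ : ∃ K, 0 ≤ K ∧ ∀ x y, |ψ x y| ≤ K * Ψ x y) :
    ∃ K, 0 ≤ K ∧ ∀ x y, |φ x y + ψ x y| ≤ K * (Φ x y + Ψ x y) := by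
  obtain ⟨K, hK, h₁⟩ := h₁
  obtain ⟨L, hL, h₂⟩ := h₂
  refine ⟨K + L, by positivity, fun x y => (abs_add_le _ _).trans ?_⟩
  nlinarith [h₁ x y, h₂ x y, mul_nonneg hK (hΨ x y), mul_nonneg hL (hΦ x y)]

theorem exists_abs_quadratic_le {i₀ i₁ i₂ : ℕ} (h₂ : a₂.natDegree ≤ i₂) (h₁ : a₁.natDegree ≤ i₁)
    (h₀ : a₀.natDegree ≤ i₀) :
    ∃ K, 0 ≤ K ∧ ∀ x y, |a₂.eval x * y ^ 2 + a₁.eval x * y + a₀.eval x| ≤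
      K * ((1 + |x|) ^ i₂ * (1 + |y|) ^ 2 + (1 + |x|) ^ i₁ * (1 + |y|) + (1 + |x|) ^ i₀) := by
  have := exists_abs_add_le (fun x y => by positivity) (fun x y => by positivity)
    (exists_abs_add_le (fun x y => by positivity) (fun x y => by positivity)
      (exists_abs_eval_mul_pow_le h₂ 2) (exists_abs_eval_mul_pow_le h₁ 1))
    (exists_abs_eval_mul_pow_le h₀ 0)
  simpa using this

theorem exists_abs_cubic_le {i₀ i₁ i₂ i₃ : ℕ} (h₃ : a₃.natDegree ≤ i₃) (h₂ : a₂.natDegree ≤ i₂)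
    (h₁ : a₁.natDegree ≤ i₁) (h₀ : a₀.natDegree ≤ i₀) :
    ∃ K, 0 ≤ K ∧ ∀ x y, |a₃.eval x * y ^ 3 + (a₂.eval x * y ^ 2 + a₁.eval x * y + a₀.eval x)| ≤
      K * ((1 + |x|) ^ i₃ * (1 + |y|) ^ 3 + ((1 + |x|) ^ i₂ * (1 + |y|) ^ 2 +
        (1 + |x|) ^ i₁ * (1 + |y|) + (1 + |x|) ^ i₀)) :=
  exists_abs_add_le (fun x y => by positivity) (fun x y => by positivity)
    (exists_abs_eval_mul_pow_le h₃ 3) (exists_abs_quadratic_le h₂ h₁ h₀)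

theorem one_add_abs_pow_four_le (x : ℝ) : (1 + |x|) ^ 4 ≤ 8 * (1 + x ^ 4) := by
  rw [← Even.pow_abs (by decide : Even 4) x]
  nlinarith [sq_nonneg (1 - |x|), sq_nonneg (1 - |x| ^ 2)]

theorem one_add_abs_pow_three_le (x : ℝ) : (1 + |x|) ^ 3 ≤ 4 * (1 + |x ^ 3|) := by
  rw [abs_pow]
  nlinarith [sq_nonneg (1 - |x|), abs_nonneg x]

theorem _root_.JacPair.injective_quartic (h : JacPair f g) {α : ℝ} (hα : α ≠ 0)
    (hf : ∀ x y, f (x, y) = α * y ^ 4 + a₃.eval x * y ^ 3 + a₂.eval x * y ^ 2 +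
      a₁.eval x * y + a₀.eval x) (h₃ : a₃.natDegree ≤ 1) (h₂ : a₂.natDegree ≤ 2)
    (h₁ : a₁.natDegree ≤ 3) (h₀ : (a₀ - X ^ 5).natDegree ≤ 4) :
    Function.Injective fun p => (f p, g p) := by
  have hf' : ∀ x y, f (x, y) = (C α).eval x * y ^ 4 + a₃.eval x * y ^ 3 + a₂.eval x * y ^ 2 +
      a₁.eval x * y + a₀.eval x := by simpa using hf
  refine h.injective_of_derivative (fun x y => hasDerivAt_eval_quartic y x hf') (fun k => ?_)
    (exists_coercive_of_natDegree_le hf' (by simp) (by omega) (by omega) (by omega) h₀)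
  obtain ⟨N, hN, e⟩ := exists_abs_cubic_le h₃ h₂ h₁ h₀
  obtain ⟨L, hL, d⟩ := exists_abs_cubic_le (a₃ := a₃.derivative) (i₃ := 0) (a₂ := a₂.derivative)
    (i₂ := 1) (a₁ := a₁.derivative) (i₁ := 2) (a₀ := (a₀ - X ^ 5).derivative) (i₀ := 3)
    ((natDegree_derivative_le _).trans (by omega)) ((natDegree_derivative_le _).trans (by omega))
    ((natDegree_derivative_le _).trans (by omega)) ((natDegree_derivative_le _).trans (by omega))
  have hα' : 0 < |α| := abs_pos.2 hα
  set K := 8 + 2 * L + 8 / |α| * (N + 1 + |k|) with hK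
  have hK0 : 0 ≤ K := by positivity
  refine ⟨max (4 * K) (K * (3 + 4 * K) * (4 * K * (K * (3 + 4 * K)) ^ 3)), fun x y hk hd => ?_⟩
  refine (show |y| < 1 + |y| by linarith).trans_le ?_
  have e' := e x y
  have d' := d x y
  simp only [derivative_C, eval_zero, zero_mul, zero_add] at hd
  simp only [derivative_sub, derivative_X_pow, eval_sub, eval_mul, eval_pow, eval_X, eval_C,
    pow_zero, pow_one, one_mul] at e' d'
  norm_num at d'
  have hm : 1 ≤ 1 + |x| := by linarith [abs_nonneg x]
  have hw : 1 ≤ 1 + |y| := by linarith [abs_nonneg y]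
  have hmx := one_add_abs_pow_four_le x
  have hwy := one_add_abs_pow_four_le y
  have hx5 : |x ^ 5| ≤ (1 + |x|) ^ 5 := by rw [abs_pow]; gcongr; linarith
  have hαy : |α| * y ^ 4 = |α * y ^ 4| := by
    rw [abs_mul, abs_of_nonneg (by positivity : 0 ≤ y ^ 4)]
  have hαk : |α * y ^ 4| ≤ |k| + |a₃.eval x * y ^ 3 + (a₂.eval x * y ^ 2 + a₁.eval x * y +
      (a₀.eval x - x ^ 5))| + |x ^ 5| := by
    have : α * y ^ 4 = k - (a₃.eval x * y ^ 3 + (a₂.eval x * y ^ 2 + a₁.eval x * y +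
      (a₀.eval x - x ^ 5))) - x ^ 5 := by rw [← hk, hf]; ring
    rw [this]
    exact (abs_sub _ _).trans (by gcongr; exact abs_sub _ _)
  refine bounded_of_quartic_estimates (m := 1 + |x|) hK0 hm hw ?_ ?_
  all_goals
    generalize 1 + |x| = m at *
    generalize 1 + |y| = w at *
    have hm5 : m ^ 4 ≤ m ^ 5 := pow_le_pow_right₀ hm (by norm_num)
    have hm5' : 1 ≤ m ^ 5 := one_le_pow₀ hm
    have hm3 : 1 ≤ m ^ 3 := one_le_pow₀ hm
  · have h5 : 5 * x ^ 4 ≤ L * (w ^ 3 + (m * w ^ 2 + m ^ 2 * w + m ^ 3)) := by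
      linarith [(abs_le.1 d').1]
    have hA : 0 ≤ w ^ 3 + m * w ^ 2 + m ^ 2 * w := by positivity
    set A := w ^ 3 + m * w ^ 2 + m ^ 2 * w with hA'
    have : m ^ 4 ≤ (8 + 2 * L) * (A + m ^ 3) := by nlinarith
    refine this.trans (mul_le_mul_of_nonneg_right ?_ (by positivity))
    rw [hK]
    have : 0 ≤ 8 / |α| * (N + 1 + |k|) := by positivity
    linarith
  · have hA : 0 ≤ m * w ^ 3 + m ^ 2 * w ^ 2 + m ^ 3 * w := by positivity
    set A := m * w ^ 3 + m ^ 2 * w ^ 2 + m ^ 3 * w with hA'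
    have h6 : |α| * y ^ 4 ≤ (N + 1 + |k|) * (A + m ^ 5) := by
      rw [hαy]
      have e1 : N * (m * w ^ 3 + (m ^ 2 * w ^ 2 + m ^ 3 * w + m ^ 4)) ≤ N * (A + m ^ 5) := by
        exact mul_le_mul_of_nonneg_left (by linarith) hN
      have e2 : |k| * 1 ≤ |k| * (A + m ^ 5) := by gcongr; linarith
      linarith
    have h7 : y ^ 4 ≤ (N + 1 + |k|) * (A + m ^ 5) / |α| := by
      rw [le_div_iff₀ hα']; linarith
    have h8 : 8 * ((N + 1 + |k|) * (A + m ^ 5) / |α|) = 8 / |α| * (N + 1 + |k|) * (A + m ^ 5) := by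
      ring
    have h9 : 0 ≤ L * (A + m ^ 5) := by positivity
    have h10 : K * (A + m ^ 5) = 8 * (A + m ^ 5) + 2 * (L * (A + m ^ 5)) +
        8 / |α| * (N + 1 + |k|) * (A + m ^ 5) := by rw [hK]; ring
    linarith

theorem _root_.JacPair.injective_cubic (h : JacPair f g) {β : ℝ} (hβ : β ≠ 0)
    (hf : ∀ x y, f (x, y) = β * y ^ 3 + a₂.eval x * y ^ 2 + a₁.eval x * y + a₀.eval x)
    (h₂ : a₂.natDegree ≤ 1) (h₁ : a₁.natDegree ≤ 3) (h₀ : (a₀ - X ^ 5).natDegree ≤ 4) :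
    Function.Injective fun p => (f p, g p) := by
  have hf' : ∀ x y, f (x, y) = (0 : Polynomial ℝ).eval x * y ^ 4 + (C β).eval x * y ^ 3 +
      a₂.eval x * y ^ 2 + a₁.eval x * y + a₀.eval x := by simpa using hf
  refine h.injective_of_derivative (fun x y => hasDerivAt_eval_quartic y x hf') (fun k => ?_)
    (exists_coercive_of_natDegree_le hf' (by simp) (by simp) (by omega) (by omega) h₀)
  obtain ⟨N, hN, e⟩ := exists_abs_quadratic_le h₂ h₁ h₀
  obtain ⟨L, hL, d⟩ := exists_abs_quadratic_le (a₂ := a₂.derivative)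
    (i₂ := 0) (a₁ := a₁.derivative) (i₁ := 2) (a₀ := (a₀ - X ^ 5).derivative) (i₀ := 3)
    ((natDegree_derivative_le _).trans (by omega)) ((natDegree_derivative_le _).trans (by omega))
    ((natDegree_derivative_le _).trans (by omega))
  have hβ' : 0 < |β| := abs_pos.2 hβ
  set K := 8 + 2 * L + 4 / |β| * (N + 1 + |k|) with hK
  have hK0 : 0 ≤ 4 / |β| * (N + 1 + |k|) := by positivity
  have hK1 : 1 ≤ K := by linarith
  refine ⟨_, fun x y hk hd => (show |y| < 1 + |y| by linarith).trans_le
    (bounded_of_cubic_estimates (m := 1 + |x|) hK1 (by linarith [abs_nonneg x])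
      (by linarith [abs_nonneg y]) ?_ ?_)⟩
  all_goals
    have e' := e x y
    have d' := d x y
    simp only [derivative_C, derivative_zero, eval_zero, zero_mul, zero_add] at hd
    simp only [derivative_sub, derivative_X_pow, eval_sub, eval_mul, eval_pow, eval_X, eval_C,
      pow_zero, pow_one, one_mul] at e' d'
    norm_num at d'
    have hm : 1 ≤ 1 + |x| := by linarith [abs_nonneg x]
    have hw : 1 ≤ 1 + |y| := by linarith [abs_nonneg y]
    have hmx := one_add_abs_pow_four_le x
    have hwy := one_add_abs_pow_three_le y
    have hx5 : |x ^ 5| ≤ (1 + |x|) ^ 5 := by rw [abs_pow]; gcongr; linarith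
    have hβk : |β * y ^ 3| ≤ |k| + |a₂.eval x * y ^ 2 + a₁.eval x * y +
        (a₀.eval x - x ^ 5)| + |x ^ 5| := by
      have : β * y ^ 3 = k - (a₂.eval x * y ^ 2 + a₁.eval x * y +
        (a₀.eval x - x ^ 5)) - x ^ 5 := by rw [← hk, hf]; ring
      rw [this]
      exact (abs_sub _ _).trans (by gcongr; exact abs_sub _ _)
    generalize 1 + |x| = m at *
    generalize 1 + |y| = w at *
    have hm5 : m ^ 4 ≤ m ^ 5 := pow_le_pow_right₀ hm (by norm_num)
    have hm5' : 1 ≤ m ^ 5 := one_le_pow₀ hm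
    have hm3 : 1 ≤ m ^ 3 := one_le_pow₀ hm
  · have h5 : 5 * x ^ 4 ≤ L * (w ^ 2 + m ^ 2 * w + m ^ 3) := by
      linarith [(abs_le.1 d').1]
    have hA : 0 ≤ w ^ 2 + m ^ 2 * w := by positivity
    set A := w ^ 2 + m ^ 2 * w with hA'
    have : m ^ 4 ≤ (8 + 2 * L) * (A + m ^ 3) := by nlinarith
    exact this.trans (mul_le_mul_of_nonneg_right (by linarith) (by positivity))
  · have hA : 0 ≤ m * w ^ 2 + m ^ 3 * w := by positivity
    set A := m * w ^ 2 + m ^ 3 * w with hA'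
    have h6 : |β| * |y ^ 3| ≤ (N + 1 + |k|) * (A + m ^ 5) := by
      rw [← abs_mul]
      have e1 : N * (A + m ^ 4) ≤ N * (A + m ^ 5) := by
        gcongr
      have e2 : |k| * 1 ≤ |k| * (A + m ^ 5) := by gcongr; linarith
      linarith
    have h7 : |y ^ 3| ≤ (N + 1 + |k|) * (A + m ^ 5) / |β| := by
      rw [le_div_iff₀ hβ']; linarith
    have h8 : 4 * ((N + 1 + |k|) * (A + m ^ 5) / |β|) = 4 / |β| * (N + 1 + |k|) * (A + m ^ 5) := by
      ring
    have h9 : 0 ≤ L * (A + m ^ 5) := by positivity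
    have h10 : K * (A + m ^ 5) = 8 * (A + m ^ 5) + 2 * (L * (A + m ^ 5)) +
        4 / |β| * (N + 1 + |k|) * (A + m ^ 5) := by rw [hK]; ring
    linarith

end Polynomial

namespace Polynomial

variable {f g : ℝ × ℝ → ℝ} {a₀ a₁ a₂ : Polynomial ℝ}

open Filter Topology in
theorem _root_.JacPair.injective_of_sq_add (h : JacPair f g) (G : ℝ × ℝ ≃ₜ ℝ × ℝ) {σ : ℝ}
    {q q' : ℝ → ℝ} (hG : ∀ x y, f (G (x, y)) = σ * y ^ 2 + q x)
    (hq : ∀ x, HasDerivAt q (q' x) x) (hq' : ∀ x, q' x ≠ 0)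
    (htop : Tendsto q atTop atTop) (hbot : Tendsto q atBot atBot) :
    Function.Injective fun p => (f p, g p) := by
  have hinj : Function.Injective q := by
    intro a b hab
    by_contra hne
    wlog hlt : a < b generalizing a b
    · exact this hab.symm (Ne.symm hne) (lt_of_le_of_ne (not_lt.1 hlt) (Ne.symm hne))
    obtain ⟨c, -, hc⟩ := exists_hasDerivAt_eq_zero hlt
      (fun x _ => (hq x).continuousAt.continuousWithinAt) hab (fun x _ => hq x)
    exact hq' c hc
  refine h.injective_of_levels G (fun k => ⟨0, fun y _ x x' hx hx' => hinj ?_⟩) fun k M => ?_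
  · rw [hG] at hx hx'
    linarith
  · obtain ⟨B₁, hB₁⟩ := (htop.eventually_gt_atTop (k + |σ| * M ^ 2)).exists_forall_of_atTop
    obtain ⟨B₂, hB₂⟩ := (hbot.eventually_lt_atBot (k - |σ| * M ^ 2)).exists_forall_of_atBot
    refine ⟨max B₁ (-B₂), fun x y hy => ?_⟩
    have hσ : |σ * y ^ 2| ≤ |σ| * M ^ 2 := by
      rw [abs_mul, abs_of_nonneg (sq_nonneg y)]
      gcongr 1
      exact sq_le_sq.2 (hy.trans (le_abs_self M))
    rw [abs_le] at hσ
    rw [hG]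
    refine ⟨fun hx => ?_, fun hx => ?_⟩
    · linarith [hB₁ x ((le_max_left _ _).trans hx)]
    · linarith [hB₂ x (by linarith [le_max_right B₁ (-B₂)])]

theorem pos_or_neg_of_eval_ne_zero {p : Polynomial ℝ} (hp : ∀ x, p.eval x ≠ 0) :
    (∀ x, 0 < p.eval x) ∨ ∀ x, p.eval x < 0 := by
  rcases lt_or_gt_of_ne (hp 0) with h0 | h0
  · right
    intro x
    by_contra! hx
    obtain ⟨c, hc⟩ := mem_range_of_exists_le_of_exists_ge p.continuous ⟨0, h0.le⟩ ⟨x, hx⟩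
    exact hp c hc
  · left
    intro x
    by_contra! hx
    obtain ⟨c, hc⟩ := mem_range_of_exists_le_of_exists_ge p.continuous ⟨x, hx⟩ ⟨0, h0.le⟩
    exact hp c hc

/-- The change of variables completing the square in `a₂ y² + a₁ y`. -/
noncomputable def completeSquare (a₁ a₂ : Polynomial ℝ) (ha : ∀ x, a₂.eval x ≠ 0) :
    ℝ × ℝ ≃ₜ ℝ × ℝ where
  toFun p := (p.1, p.2 / √|a₂.eval p.1| - a₁.eval p.1 / (2 * a₂.eval p.1))
  invFun p := (p.1, √|a₂.eval p.1| * (p.2 + a₁.eval p.1 / (2 * a₂.eval p.1)))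
  left_inv p := by
    have := (Real.sqrt_pos.2 (abs_pos.2 (ha p.1))).ne'
    ext
    · rfl
    · simp only [sub_add_cancel]
      field_simp
  right_inv p := by
    have := (Real.sqrt_pos.2 (abs_pos.2 (ha p.1))).ne'
    ext
    · rfl
    · simp only [mul_div_cancel_left₀ _ this, add_sub_cancel_right]
  continuous_toFun := by
    have h₁ := a₁.continuous
    have h₂ := a₂.continuous
    have h₃ : Continuous fun p : ℝ × ℝ => √|a₂.eval p.1| := by fun_prop
    refine continuous_fst.prodMk ((continuous_snd.div h₃ fun p =>
      (Real.sqrt_pos.2 (abs_pos.2 (ha p.1))).ne').sub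
      (Continuous.div (by fun_prop) (by fun_prop) fun p => mul_ne_zero two_ne_zero (ha p.1)))
  continuous_invFun := by
    have h₁ := a₁.continuous
    have h₂ := a₂.continuous
    have h₃ : Continuous fun p : ℝ × ℝ => √|a₂.eval p.1| := by fun_prop
    refine continuous_fst.prodMk (h₃.mul (continuous_snd.add
      (Continuous.div (by fun_prop) (by fun_prop) fun p => mul_ne_zero two_ne_zero (ha p.1))))

open Filter Topology in
theorem _root_.JacPair.injective_quadratic (h : JacPair f g)
    (hf : ∀ x y, f (x, y) = a₂.eval x * y ^ 2 + a₁.eval x * y + a₀.eval x)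
    (ha : ∀ x, a₂.eval x ≠ 0) {n : ℕ} (hn : Odd n) {c : ℝ} (hc : 0 < c)
    (hdeg : ∀ k, (C 4 * a₀ * a₂ ^ 2 - a₁ ^ 2 * a₂ - C (4 * k) * a₂ ^ 2).TopCoeff n c) :
    Function.Injective fun p => (f p, g p) := by
  obtain ⟨σ, hσ⟩ : ∃ σ : ℝ, ∀ x, a₂.eval x = σ * |a₂.eval x| := by
    rcases pos_or_neg_of_eval_ne_zero ha with h | h
    · exact ⟨1, fun x => by rw [abs_of_pos (h x), one_mul]⟩
    · exact ⟨-1, fun x => by rw [abs_of_neg (h x)]; ring⟩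
  have hlim : ∀ k, Tendsto (fun x => (C 4 * a₀ * a₂ ^ 2 - a₁ ^ 2 * a₂ - C (4 * k) * a₂ ^ 2).eval x)
      atTop atTop ∧ Tendsto (fun x => (C 4 * a₀ * a₂ ^ 2 - a₁ ^ 2 * a₂ -
        C (4 * k) * a₂ ^ 2).eval x) atBot atBot := fun k =>
    tendsto_eval_of_odd_natDegree (by rwa [(hdeg k).natDegree_eq hc.ne'])
      (by rwa [(hdeg k).leadingCoeff_eq hc.ne'])
  have hsub : ∀ k x, (a₀.eval x - a₁.eval x ^ 2 / (4 * a₂.eval x) - k) * (4 * a₂.eval x ^ 2) =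
      (C 4 * a₀ * a₂ ^ 2 - a₁ ^ 2 * a₂ - C (4 * k) * a₂ ^ 2).eval x := by
    intro k x
    have := ha x
    simp
    field_simp
  have hpos : ∀ x, 0 < 4 * a₂.eval x ^ 2 := fun x => by have := ha x; positivity
  refine h.injective_of_sq_add (completeSquare a₁ a₂ ha) (σ := σ)
    (q := fun x => a₀.eval x - a₁.eval x ^ 2 / (4 * a₂.eval x))
    (q' := fun x => (C 4 * a₀.derivative * a₂ ^ 2 - C 2 * a₁.derivative * a₁ * a₂ +
      a₂.derivative * a₁ ^ 2).eval x / (4 * a₂.eval x ^ 2)) ?_ ?_ ?_ ?_ ?_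
  · intro x y
    have hs := Real.sq_sqrt (abs_nonneg (a₂.eval x))
    have h0 := (Real.sqrt_pos.2 (abs_pos.2 (ha x))).ne'
    have hx := ha x
    change f (x, y / √|a₂.eval x| - a₁.eval x / (2 * a₂.eval x)) = _
    have h1 : a₂.eval x * (y / √|a₂.eval x|) ^ 2 = σ * y ^ 2 := by
      rw [div_pow, hs]
      nth_rewrite 1 [hσ x]
      have := (abs_pos.2 hx).ne'
      field_simp
    rw [hf, ← h1]
    field_simp
    ring
  · intro x
    have hx := ha x
    refine ((a₀.hasDerivAt x).sub (((a₁.hasDerivAt x).pow 2).div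
      ((a₂.hasDerivAt x).const_mul 4) (by positivity))).congr_deriv ?_
    simp
    field_simp
    ring
  · intro x
    exact div_ne_zero (h.critical_value_deriv_ne_zero hf (ha x)) (hpos x).ne'
  · refine tendsto_atTop.2 fun k => ?_
    filter_upwards [(hlim k).1.eventually_ge_atTop 0] with x hx
    rw [← hsub] at hx
    linarith [nonneg_of_mul_nonneg_left hx (hpos x)]
  · refine tendsto_atBot.2 fun k => ?_
    filter_upwards [(hlim k).2.eventually_le_atBot 0] with x hx
    rw [← hsub] at hx
    have := nonpos_of_mul_nonpos_left hx (hpos x)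
    linarith

theorem _root_.JacPair.injective_quadratic_of_const (h : JacPair f g) {α : ℝ} (hα : α ≠ 0)
    (hf : ∀ x y, f (x, y) = α * y ^ 2 + a₁.eval x * y + a₀.eval x)
    (h₁ : a₁.natDegree ≤ 3) (h₀ : a₀.TopCoeff 5 1) : Function.Injective fun p => (f p, g p) := by
  have hf' : ∀ x y, f (x, y) = (C α).eval x * y ^ 2 + a₁.eval x * y + a₀.eval x := by
    simpa using hf
  have tα := TopCoeff.const α
  by_cases h3 : a₁.coeff 3 = 0
  · have t₁ : a₁.TopCoeff 2 _ := TopCoeff.mk (by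
      by_contra! hcon
      have h4 : a₁.natDegree = 3 := by omega
      rw [← h4, coeff_natDegree, leadingCoeff_eq_zero] at h3
      simp [h3] at h4)
    refine h.injective_quadratic hf' (fun x => by simpa using hα) (n := 5) (by decide)
      (c := 4 * α ^ 2) (by positivity) fun k => ?_
    refine (((((TopCoeff.const 4).mul h₀).mul (tα.pow 2)).sub
      (((t₁.pow 2).mul tα).weaken (by norm_num))).sub
      (((TopCoeff.const (4 * k)).mul (tα.pow 2)).weaken (by norm_num))).congr ?_
    ring
  · exfalso
    have t₁ := TopCoeff.mk h₁
    have tN : (C 4 * a₀.derivative * C α ^ 2 - C 2 * a₁.derivative * a₁ * C α +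
        (C α).derivative * a₁ ^ 2).TopCoeff 5 (-(6 * α * a₁.coeff 3 ^ 2)) := by
      rw [derivative_C, zero_mul, add_zero]
      refine (((((TopCoeff.const 4).mul h₀.derivative).mul (tα.pow 2)).weaken (by norm_num)).sub
        ((((TopCoeff.const 2).mul t₁.derivative).mul t₁).mul tα)).congr ?_
      norm_num
      ring
    have hodd := tN.natDegree_eq (neg_ne_zero.2 (by positivity))
    obtain ⟨x, hx⟩ := surjective_eval_of_odd_natDegree (by rw [hodd]; decide) 0
    exact h.critical_value_deriv_ne_zero hf' (by simpa using hα) hx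

theorem _root_.JacPair.injective_quadratic_of_topCoeff (h : JacPair f g) {γ : ℝ} (hγ : γ ≠ 0)
    (hf : ∀ x y, f (x, y) = a₂.eval x * y ^ 2 + a₁.eval x * y + a₀.eval x)
    (ha : ∀ x, a₂.eval x ≠ 0) (h₂ : a₂.TopCoeff 2 γ)
    (h₁ : a₁.natDegree ≤ 3) (h₀ : a₀.TopCoeff 5 1) : Function.Injective fun p => (f p, g p) := by
  have t₁ := TopCoeff.mk h₁
  refine h.injective_quadratic hf ha (n := 9) (by decide)
    (c := 4 * γ ^ 2) (by positivity) fun k => ?_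
  refine (((((TopCoeff.const 4).mul h₀).mul (h₂.pow 2)).sub
    (((t₁.pow 2).mul h₂).weaken (by norm_num))).sub
    (((TopCoeff.const (4 * k)).mul (h₂.pow 2)).weaken (by norm_num))).congr ?_
  ring

theorem exists_eq_mul_of_eval_eq_zero {p : Polynomial ℝ} {r : ℝ} (h : p.eval r = 0) :
    ∃ q, p = (X - C r) * q :=
  dvd_iff_isRoot.2 h

open Filter Topology in
/-- The sign of the derivative of the critical value near a simple zero of the leading
coefficient. -/
theorem _root_.JacPair.eventually_critical_value_deriv_pos (h : JacPair f g) {d : Polynomial ℝ}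
    {r : ℝ} (hf : ∀ x y, f (x, y) = ((X - C r) * d).eval x * y ^ 2 + a₁.eval x * y + a₀.eval x)
    (hd : d.eval r ≠ 0) :
    ∀ᶠ x in 𝓝[≠] r, 0 < d.eval r * (C (4 : ℝ) * a₀.derivative * ((X - C r) * d) ^ 2 -
      C (2 : ℝ) * a₁.derivative * a₁ * ((X - C r) * d) +
      ((X - C r) * d).derivative * a₁ ^ 2).eval x := by
  by_cases hr : a₁.eval r = 0
  · obtain ⟨b, rfl⟩ := exists_eq_mul_of_eval_eq_zero hr
    set N := C 4 * a₀.derivative * d ^ 2 - C 2 * ((X - C r) * b).derivative * b * d +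
      ((X - C r) * d).derivative * b ^ 2 with hN
    have hdisc : b.eval r ^ 2 < 4 * d.eval r * a₀.derivative.eval r := by
      by_contra! hcon
      obtain ⟨t, ht⟩ : ∃ t, t ^ 2 = b.eval r ^ 2 - 4 * d.eval r * a₀.derivative.eval r :=
        ⟨_, Real.sq_sqrt (sub_nonneg.2 hcon)⟩
      refine h.not_critical_quadratic hf (x := r) (y := (-b.eval r + t) / (2 * d.eval r))
        (by simp) ?_
      simp
      field_simp
      linear_combination ht
    have hNr : 0 < d.eval r * N.eval r := by
      have : d.eval r * N.eval r = d.eval r ^ 2 * (4 * d.eval r * a₀.derivative.eval r -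
        b.eval r ^ 2) := by simp [hN]; ring
      rw [this]
      exact mul_pos (by positivity) (sub_pos.2 hdisc)
    have hc : Continuous fun x => d.eval r * N.eval x := continuous_const.mul N.continuous
    filter_upwards [nhdsWithin_le_nhds (hc.continuousAt.eventually (lt_mem_nhds hNr)),
      self_mem_nhdsWithin] with x hx hxr
    have h0 : x - r ≠ 0 := sub_ne_zero.2 hxr
    have : 0 < (x - r) ^ 2 * (d.eval r * N.eval x) := mul_pos (by positivity) hx
    refine this.trans_eq ?_
    simp [hN]
    ring
  · set N := C 4 * a₀.derivative * ((X - C r) * d) ^ 2 -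
      C 2 * a₁.derivative * a₁ * ((X - C r) * d) + ((X - C r) * d).derivative * a₁ ^ 2 with hN
    have hNr : 0 < d.eval r * N.eval r := by
      have : d.eval r * N.eval r = d.eval r ^ 2 * a₁.eval r ^ 2 := by simp [hN]; ring
      rw [this]
      positivity
    have hc : Continuous fun x => d.eval r * N.eval x := continuous_const.mul N.continuous
    exact nhdsWithin_le_nhds (hc.continuousAt.eventually (lt_mem_nhds hNr))

open Filter Topology Set in
theorem _root_.JacPair.not_quadratic_of_ne (h : JacPair f g) {γ r s : ℝ} (hγ : γ ≠ 0)
    (hf : ∀ x y, f (x, y) = γ * (x - r) * (x - s) * y ^ 2 + a₁.eval x * y + a₀.eval x)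
    (hrs : r < s) : False := by
  have er := h.eventually_critical_value_deriv_pos (a₁ := a₁) (a₀ := a₀) (r := r)
    (d := C γ * (X - C s)) (fun x y => by simp only [hf, eval_mul, eval_sub, eval_X, eval_C]; ring)
    (by simpa [sub_eq_zero, hγ] using hrs.ne)
  have es := h.eventually_critical_value_deriv_pos (a₁ := a₁) (a₀ := a₀) (r := s)
    (d := C γ * (X - C r)) (fun x y => by simp only [hf, eval_mul, eval_sub, eval_X, eval_C]; ring)
    (by simpa [sub_eq_zero, hγ] using hrs.ne')
  rw [show (X - C s) * (C γ * (X - C r)) = (X - C r) * (C γ * (X - C s)) by ring] at es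
  set N := C 4 * a₀.derivative * ((X - C r) * (C γ * (X - C s))) ^ 2 -
    C 2 * a₁.derivative * a₁ * ((X - C r) * (C γ * (X - C s))) +
    ((X - C r) * (C γ * (X - C s))).derivative * a₁ ^ 2 with hN
  obtain ⟨u, hu, hur⟩ := ((er.filter_mono (nhdsGT_le_nhdsNE r)).and
    (Ioo_mem_nhdsGT (show r < (r + s) / 2 by linarith))).exists
  obtain ⟨v, hv, hvs⟩ := ((es.filter_mono (nhdsLT_le_nhdsNE s)).and
    (Ioo_mem_nhdsLT (show (r + s) / 2 < s by linarith))).exists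
  have hne : ∀ x ∈ Ioo r s, N.eval x ≠ 0 := fun x hx =>
    h.critical_value_deriv_ne_zero (a₂ := (X - C r) * (C γ * (X - C s)))
      (fun x y => by simp only [hf, eval_mul, eval_sub, eval_X, eval_C]; ring)
      (by simpa [sub_eq_zero, hγ] using And.intro hx.1.ne' hx.2.ne)
  simp only [eval_mul, eval_C, eval_sub, eval_X] at hu hv
  have huv : u ≤ v := (hur.2.trans hvs.1).le
  have hprod : N.eval u * N.eval v < 0 := by
    have h1 := mul_pos hu hv
    have h2 : γ * (r - s) * N.eval u * (γ * (s - r) * N.eval v) =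
      -((γ * (s - r)) ^ 2 * (N.eval u * N.eval v)) := by ring
    rw [h2] at h1
    by_contra! hcon
    nlinarith [mul_nonneg (sq_nonneg (γ * (s - r))) hcon]
  have hmem : (0 : ℝ) ∈ uIcc (N.eval u) (N.eval v) := by
    rw [mem_uIcc]
    rcases mul_neg_iff.1 hprod with h | h
    · exact Or.inr ⟨h.2.le, h.1.le⟩
    · exact Or.inl ⟨h.1.le, h.2.le⟩
  obtain ⟨x, hx, hx0⟩ := intermediate_value_uIcc (N.continuous.continuousOn (s := uIcc u v)) hmem
  rw [uIcc_of_le huv] at hx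
  exact hne x ⟨hur.1.trans_le hx.1, hx.2.trans_lt hvs.2⟩ hx0

theorem _root_.JacPair.not_quadratic_of_sq (h : JacPair f g) {γ r : ℝ} (hγ : γ ≠ 0)
    (hf : ∀ x y, f (x, y) = γ * (x - r) ^ 2 * y ^ 2 + a₁.eval x * y + a₀.eval x)
    (h₁ : a₁.natDegree ≤ 3) (h₀ : a₀.TopCoeff 5 1) : False := by
  have hf' : ∀ x y, f (x, y) = (C γ * (X - C r) ^ 2).eval x * y ^ 2 + a₁.eval x * y +
    a₀.eval x := by simpa using hf
  by_cases hr : a₁.eval r = 0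
  · obtain ⟨b, rfl⟩ := exists_eq_mul_of_eval_eq_zero hr
    by_cases hb : b.eval r = 0
    · obtain ⟨l, rfl⟩ := exists_eq_mul_of_eval_eq_zero hb
      refine (h.shear (C (-(2 * γ)⁻¹) * l)).not_square_add hγ (r := r)
        (q := C γ * (X - C r) ^ 2 * (C (-(2 * γ)⁻¹) * l) ^ 2 +
          (X - C r) * ((X - C r) * l) * (C (-(2 * γ)⁻¹) * l) + a₀) fun x y => ?_
      simp [hf]
      field_simp
      ring
    · refine h.not_critical_quadratic hf' (x := r) (y := -a₀.derivative.eval r / b.eval r)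
        (by simp) ?_
      simp [derivative_X_sub_C_pow]
      field_simp
      ring
  · have t₁ := TopCoeff.mk h₁
    have tl := TopCoeff.X_sub r
    set N := C (4 * γ ^ 2) * a₀.derivative * (X - C r) ^ 3 -
      C (2 * γ) * a₁.derivative * a₁ * (X - C r) + C (2 * γ) * a₁ ^ 2 with hN
    have tN : N.TopCoeff 7 (20 * γ ^ 2) := by
      refine (((((TopCoeff.const _).mul h₀.derivative).mul (tl.pow 3)).sub
        (((((TopCoeff.const _).mul t₁.derivative).mul t₁).mul tl).weaken (by norm_num))).add
        (((TopCoeff.const _).mul (t₁.pow 2)).weaken (by norm_num))).congr ?_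
      norm_num
      ring
    obtain ⟨x, hx⟩ := surjective_eval_of_odd_natDegree
      (by rw [tN.natDegree_eq (by positivity)]; decide : Odd N.natDegree) 0
    have hxr : x - r ≠ 0 := by
      intro h0
      obtain rfl := sub_eq_zero.1 h0
      simp [hN, hγ, hr] at hx
    refine h.critical_value_deriv_ne_zero hf' (x := x) (by simpa [hγ] using hxr) ?_
    simp [hN] at hx
    simp [derivative_X_sub_C_pow]
    linear_combination (x - r) * hx

end Polynomial

namespace Polynomial

variable {f g : ℝ × ℝ → ℝ} {a₀ a₁ a₂ q : Polynomial ℝ}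

open Filter Topology in
theorem _root_.JacPair.injective_sq_of_tendsto (h : JacPair f g) {α c r b : ℝ} (hα : 0 < α)
    (hf : ∀ x y, f (x, y) = α * (x - r) * y ^ 2 + c * y + q.eval x)
    (hb : ∀ x, b ≤ q.derivative.eval x)
    (hq : Tendsto (fun x => q.eval x) atTop atTop ∧ Tendsto (fun x => q.eval x) atBot atBot) :
    Function.Injective fun p => (f p, g p) := by
  refine h.injective_of_derivative (f' := fun x y => α * y ^ 2 + q.derivative.eval x)
    (fun x y => ?_) (fun k => ⟨|b| / α + 1, fun x y _ hd => ?_⟩) fun k M => ?_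
  · simp only [hf]
    refine ((((((hasDerivAt_id x).sub_const r).const_mul α).mul_const (y ^ 2)).add_const
      (c * y)).add (q.hasDerivAt x)).congr_deriv ?_
    ring
  · have h1 : y ^ 2 ≤ |b| / α := by
      rw [le_div_iff₀ hα]
      linarith [hb x, neg_abs_le b]
    have h2 : 0 ≤ |b| / α := by positivity
    refine abs_lt_of_sq_lt_sq ?_ (by positivity)
    nlinarith
  · obtain ⟨B₁, hB₁⟩ := (hq.1.eventually_gt_atTop (k + |c| * |M|)).exists_forall_of_atTop
    obtain ⟨B₂, hB₂⟩ := (hq.2.eventually_lt_atBot (k - |c| * |M|)).exists_forall_of_atBot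
    refine ⟨max (|r|) (max B₁ (-B₂)), fun x y hy => ?_⟩
    have hcy : |c * y| ≤ |c| * |M| := by
      rw [abs_mul]
      exact mul_le_mul_of_nonneg_left (hy.trans (le_abs_self M)) (abs_nonneg c)
    rw [abs_le] at hcy
    have e1 := le_max_left |r| (max B₁ (-B₂))
    have e2 := le_max_right |r| (max B₁ (-B₂))
    have e3 := le_max_left B₁ (-B₂)
    have e4 := le_max_right B₁ (-B₂)
    have hy2 : 0 ≤ α * y ^ 2 := by positivity
    rw [hf]
    refine ⟨fun hx => ?_, fun hx => ?_⟩
    · have := hB₁ x (by linarith)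
      nlinarith [mul_nonneg hy2 (show 0 ≤ x - r by linarith [le_abs_self r])]
    · have := hB₂ x (by linarith)
      nlinarith [mul_nonneg hy2 (show 0 ≤ r - x by linarith [neg_abs_le r])]

theorem exists_le_eval_of_nonneg {ψ : Polynomial ℝ} {α r c : ℝ} (hα : 0 < α)
    (hw : ∀ x, 0 ≤ 4 * α * ψ.eval x * (x - r) ^ 2 + c ^ 2) : ∃ b, ∀ x, b ≤ ψ.eval x := by
  obtain ⟨z, -, hz⟩ := (isCompact_Icc (a := r - 1) (b := r + 1)).exists_isMinOn
    ⟨r, by simp⟩ ψ.continuous.continuousOn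
  refine ⟨min (ψ.eval z) (-c ^ 2 / (4 * α)), fun x => ?_⟩
  by_cases hx : x ∈ Set.Icc (r - 1) (r + 1)
  · exact (min_le_left _ _).trans (hz hx)
  · refine (min_le_right _ _).trans ?_
    have h1 : 1 ≤ (x - r) ^ 2 := by
      simp only [Set.mem_Icc, not_and_or, not_le] at hx
      rcases hx with hx | hx <;> nlinarith
    rw [div_le_iff₀ (by positivity)]
    by_cases h0 : 0 ≤ ψ.eval x
    · nlinarith [sq_nonneg c, mul_nonneg h0 hα.le]
    · nlinarith [hw x, mul_nonneg (mul_pos hα (neg_pos.2 (not_le.1 h0))).le (sub_nonneg.2 h1)]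

theorem odd_natDegree_of_derivative_nonneg {α r c : ℝ} (hα : 0 < α)
    (hq : q.derivative ≠ 0)
    (hw : ∀ x, 0 ≤ 4 * α * q.derivative.eval x * (x - r) ^ 2 + c ^ 2) :
    Odd q.natDegree ∧ 0 < q.leadingCoeff := by
  have hq0 : q.natDegree ≠ 0 := fun h => hq (derivative_of_natDegree_zero h)
  obtain ⟨n, hn⟩ := Nat.exists_eq_succ_of_ne_zero hq0
  have tq : q.TopCoeff (n + 1) q.leadingCoeff := ⟨hn.le, by rw [leadingCoeff, hn]⟩
  have hlc : q.leadingCoeff ≠ 0 := by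
    rw [Ne, leadingCoeff_eq_zero]
    rintro rfl
    simp at hq0
  set W := C (4 * α) * q.derivative * (X - C r) ^ 2 + C (c ^ 2) with hW
  have tW : W.TopCoeff (n + 2) (4 * α * ((n + 1) * q.leadingCoeff)) := by
    have h1 := ((TopCoeff.const (4 * α)).mul tq.derivative).mul ((TopCoeff.X_sub r).pow 2)
    have h2 := (TopCoeff.const (c ^ 2)).weaken (n := n + 2) (by omega)
    rw [show 0 + n + 2 * 1 = n + 2 by ring] at h1
    exact (h1.add h2).congr (by ring)
  have hW0 : ∀ x, 0 ≤ W.eval x := fun x => by simpa [hW] using hw x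
  have hlW : 4 * α * ((n + 1) * q.leadingCoeff) ≠ 0 := by positivity
  have hdW := tW.natDegree_eq hlW
  have heven : ¬ Odd W.natDegree := by
    intro ho
    obtain ⟨x, hx⟩ := surjective_eval_of_odd_natDegree ho (-1)
    have := hW0 x
    simp only at hx
    linarith
  have hpos : 0 < q.leadingCoeff := by
    by_contra! hneg
    have h1 := W.tendsto_atBot_of_leadingCoeff_nonpos
      (natDegree_pos_iff_degree_pos.1 (by omega)) (by
        rw [tW.leadingCoeff_eq hlW]
        exact mul_nonpos_of_nonneg_of_nonpos (by positivity)
          (mul_nonpos_of_nonneg_of_nonpos (by positivity) hneg))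
    obtain ⟨x, hx⟩ := (h1.eventually_lt_atBot 0).exists
    exact absurd (hW0 x) (not_le.2 hx)
  refine ⟨?_, hpos⟩
  rw [hn]
  rw [hdW] at heven
  grind

theorem _root_.JacPair.injective_sq_of_pos (h : JacPair f g) {α c r : ℝ} (hα : 0 < α)
    (hf : ∀ x y, f (x, y) = α * (x - r) * y ^ 2 + c * y + q.eval x) :
    Function.Injective fun p => (f p, g p) := by
  have hf' : ∀ x y, f (x, y) = (C α * (X - C r)).eval x * y ^ 2 + (C c).eval x * y + q.eval x := by
    simpa using hf
  have hcrit : ∀ x y, 2 * (α * (x - r)) * y + c = 0 → α * y ^ 2 + q.derivative.eval x ≠ 0 := by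
    intro x y hy
    simpa using h.not_critical_quadratic hf' (x := x) (y := y) (by simpa using hy)
  have hne : ∀ x, x ≠ r → 4 * α * q.derivative.eval x * (x - r) ^ 2 + c ^ 2 ≠ 0 := by
    intro x hx h0
    have hxr := sub_ne_zero.2 hx
    refine hcrit x (-c / (2 * α * (x - r))) (by field_simp; ring) ?_
    field_simp
    linear_combination h0
  have hr : c = 0 → 0 < q.derivative.eval r := by
    intro hc
    by_contra! hcon
    refine hcrit r (√(-q.derivative.eval r / α)) (by simp [hc]) ?_
    rw [Real.sq_sqrt (div_nonneg (by linarith) hα.le)]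
    field_simp
    ring
  have hw : ∀ x, 0 ≤ 4 * α * q.derivative.eval x * (x - r) ^ 2 + c ^ 2 := by
    by_cases hc : c = 0
    · have : ∀ x, q.derivative.eval x ≠ 0 := by
        intro x hx
        by_cases hxr : x = r
        · subst hxr
          exact (hr hc).ne' hx
        · exact hne x hxr (by simp [hx, hc])
      have hpos := (pos_or_neg_of_eval_ne_zero this).resolve_right
        fun h => absurd (hr hc) (not_lt.2 (h r).le)
      intro x
      have := hpos x
      positivity
    · set W := C (4 * α) * q.derivative * (X - C r) ^ 2 + C (c ^ 2) with hW
      have hWe : ∀ x, W.eval x = 4 * α * q.derivative.eval x * (x - r) ^ 2 + c ^ 2 :=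
        fun x => by simp [hW]
      have hr' : 0 < W.eval r := by rw [hWe]; simp; positivity
      have hpos := (pos_or_neg_of_eval_ne_zero (p := W) fun x => by
        by_cases hxr : x = r
        · subst hxr
          exact hr'.ne'
        · rw [hWe]
          exact hne x hxr).resolve_right fun h => absurd hr' (not_lt.2 (h r).le)
      intro x
      rw [← hWe]
      exact (hpos x).le
  by_cases hq : q.derivative = 0
  · exfalso
    obtain ⟨d, rfl⟩ : ∃ d, q = C d := ⟨_, eq_C_of_derivative_eq_zero hq⟩
    have hA : (C α * X ^ 2 : Polynomial ℝ) ≠ 0 := mul_ne_zero (by simpa using hα.ne') (by simp)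
    exact h.swap.not_affine (A := C α * X ^ 2) (B := C c * X - C (α * r) * X ^ 2 + C d)
      (r := 0) (fun x y => by simp [hf]; ring) hA (by simp)
  · obtain ⟨b, hb⟩ := exists_le_eval_of_nonneg hα hw
    have ho := odd_natDegree_of_derivative_nonneg hα hq hw
    exact h.injective_sq_of_tendsto hα hf hb (tendsto_eval_of_odd_natDegree ho.1 ho.2)

theorem _root_.JacPair.injective_quadratic_of_linear (h : JacPair f g) {α r : ℝ} (hα : α ≠ 0)
    (hf : ∀ x y, f (x, y) = α * (x - r) * y ^ 2 + a₁.eval x * y + a₀.eval x) :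
    Function.Injective fun p => (f p, g p) := by
  obtain ⟨b, hb⟩ := exists_eq_mul_of_eval_eq_zero (p := a₁ - C (a₁.eval r)) (r := r) (by simp)
  set c := a₁.eval r
  set s := C (-(2 * α)⁻¹) * b with hs
  have ha₁ : ∀ x, a₁.eval x = (x - r) * b.eval x + c := fun x => by
    have := congrArg (fun p => p.eval x) hb
    simp at this
    linarith
  have hf' : ∀ x y, f (x, y + s.eval x) = α * (x - r) * y ^ 2 + c * y +
      (C α * (X - C r) * s ^ 2 + a₁ * s + a₀).eval x := by
    intro x y
    simp [hf, ha₁, hs]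
    field_simp
    ring
  suffices hinj : Function.Injective fun p : ℝ × ℝ =>
      (f (p.1, p.2 + s.eval p.1), g (p.1, p.2 + s.eval p.1)) by
    rintro ⟨x, y⟩ ⟨x', y'⟩ hxy
    have := @hinj (x, y - s.eval x) (x', y' - s.eval x') (by simpa using hxy)
    simp only [Prod.mk.injEq] at this
    obtain ⟨rfl, h2⟩ := this
    simpa using h2
  rcases lt_or_gt_of_ne hα with hneg | hpos
  · have := (h.shear s).neg_left.injective_sq_of_pos (neg_pos.2 hneg) (c := -c) (r := r)
      (q := -(C α * (X - C r) * s ^ 2 + a₁ * s + a₀))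
      (fun x y => by simp only [hf', eval_neg]; ring)
    intro p p' hp
    exact this (by simpa using hp)
  · exact (h.shear s).injective_sq_of_pos hpos hf'

theorem _root_.JacPair.injective_affine (h : JacPair f g)
    (hf : ∀ x y, f (x, y) = a₁.eval x * y + a₀.eval x) (h₀ : a₀.TopCoeff 5 1) :
    Function.Injective fun p => (f p, g p) := by
  by_cases ha : a₁ = 0
  · have ht := tendsto_eval_of_odd_natDegree (p := a₀)
      (by rw [h₀.natDegree_eq one_ne_zero]; decide)
      (by rw [h₀.leadingCoeff_eq one_ne_zero]; exact one_pos)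
    refine h.injective_of_sq_add (Homeomorph.refl _) (σ := 0) (q := fun x => a₀.eval x)
      (fun x y => by simp [hf, ha]) (fun x => a₀.hasDerivAt x) (fun x hx => ?_) ht.1 ht.2
    refine h.not_critical_cubic (a₃ := 0) (a₂ := 0) (a₁ := 0) (a₀ := a₀) (x := x) (y := 0)
      (fun x y => by simp [hf, ha]) (by simpa using hx) (by simp)
  · have hne : ∀ r, a₁.eval r ≠ 0 := fun r hr => h.not_affine hf ha hr
    have c₁ := a₁.continuous
    have c₀ := a₀.continuous
    let G : ℝ × ℝ ≃ₜ ℝ × ℝ :=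
      { toFun := fun p => (p.2, (p.1 - a₀.eval p.2) / a₁.eval p.2)
        invFun := fun p => (a₁.eval p.1 * p.2 + a₀.eval p.1, p.1)
        left_inv := fun p => by
          have := hne p.2
          ext
          · simp only
            field_simp
            ring
          · rfl
        right_inv := fun p => by
          have := hne p.1
          ext
          · rfl
          · simp only
            field_simp
            ring
        continuous_toFun := continuous_snd.prodMk
          (Continuous.div (by fun_prop) (by fun_prop) fun p => hne p.2)
        continuous_invFun := by fun_prop }
    have hG : ∀ x y, f (G (x, y)) = x := by
      intro x y
      have := hne y
      change f (y, (x - a₀.eval y) / a₁.eval y) = x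
      rw [hf]
      field_simp
      ring
    refine h.injective_of_levels G (fun k => ⟨0, fun y _ x x' hx hx' => ?_⟩)
      fun k M => ⟨|k| + 1, fun x y _ => ⟨fun hx => ?_, fun hx => ?_⟩⟩
    · rw [hG] at hx hx'
      rw [hx, hx']
    · rw [hG]
      linarith [le_abs_self k]
    · rw [hG]
      linarith [neg_abs_le k]

theorem _root_.JacPair.injective_of_natDegree_two_le (h : JacPair f g)
    (hf : ∀ x y, f (x, y) = a₂.eval x * y ^ 2 + a₁.eval x * y + a₀.eval x)
    (h₂ : a₂.natDegree ≤ 2) (h₁ : a₁.natDegree ≤ 3) (h₀ : a₀.TopCoeff 5 1) :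
    Function.Injective fun p => (f p, g p) := by
  by_cases hz : a₂ = 0
  · exact h.injective_affine (by simpa [hz] using hf) h₀
  by_cases hroot : ∃ r, a₂.eval r = 0
  · obtain ⟨r, hr⟩ := hroot
    obtain ⟨d, rfl⟩ := exists_eq_mul_of_eval_eq_zero hr
    have hd0 : d ≠ 0 := right_ne_zero_of_mul hz
    rw [natDegree_mul (X_sub_C_ne_zero r) hd0, natDegree_X_sub_C] at h₂
    by_cases hd : d.natDegree = 0
    · rw [natDegree_eq_zero] at hd
      obtain ⟨α, rfl⟩ := hd
      exact h.injective_quadratic_of_linear (α := α) (r := r) (a₁ := a₁) (a₀ := a₀)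
        (by simpa using hd0) (fun x y => by simp only [hf, eval_mul, eval_sub, eval_X, eval_C]; ring)
    · exfalso
      have hd1 : d.natDegree = 1 := by omega
      obtain ⟨s, hs⟩ := surjective_eval_of_odd_natDegree (p := d) (by rw [hd1]; decide) 0
      obtain ⟨e, rfl⟩ := exists_eq_mul_of_eval_eq_zero hs
      have he0 : e ≠ 0 := right_ne_zero_of_mul hd0
      rw [natDegree_mul (X_sub_C_ne_zero s) he0, natDegree_X_sub_C] at hd1
      obtain ⟨γ, rfl⟩ := natDegree_eq_zero.1 (show e.natDegree = 0 by omega)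
      have hγ : γ ≠ 0 := by simpa using he0
      simp only [eval_mul, eval_sub, eval_X, eval_C] at hf
      rcases lt_trichotomy r s with hrs | rfl | hrs
      · exact h.not_quadratic_of_ne (a₁ := a₁) (a₀ := a₀) hγ (fun x y => by rw [hf]; ring) hrs
      · exact h.not_quadratic_of_sq (r := r) hγ (fun x y => by rw [hf]; ring) h₁ h₀
      · exact h.not_quadratic_of_ne (a₁ := a₁) (a₀ := a₀) hγ (fun x y => by rw [hf]; ring) hrs
  · push Not at hroot
    obtain hd | hd | hd : a₂.natDegree = 0 ∨ a₂.natDegree = 1 ∨ a₂.natDegree = 2 := by omega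
    · obtain ⟨α, rfl⟩ := natDegree_eq_zero.1 hd
      exact h.injective_quadratic_of_const (by simpa using hz) (by simpa using hf) h₁ h₀
    · obtain ⟨r, hr⟩ := surjective_eval_of_odd_natDegree (p := a₂) (by rw [hd]; decide) 0
      exact absurd hr (hroot r)
    · exact h.injective_quadratic_of_topCoeff (γ := a₂.leadingCoeff)
        (leadingCoeff_ne_zero.2 hz) hf hroot ⟨h₂, by rw [leadingCoeff, hd]⟩ h₁ h₀

theorem _root_.JacPair.injective_of_natDegree_le (h : JacPair f g) {α : ℝ} {a₃ : Polynomial ℝ}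
    (hf : ∀ x y, f (x, y) = α * y ^ 4 + a₃.eval x * y ^ 3 + a₂.eval x * y ^ 2 +
      a₁.eval x * y + a₀.eval x) (h₃ : a₃.natDegree ≤ 1) (h₂ : a₂.natDegree ≤ 2)
    (h₁ : a₁.natDegree ≤ 3) (h₀ : (a₀ - X ^ 5).natDegree ≤ 4) :
    Function.Injective fun p => (f p, g p) := by
  have t₀ : a₀.TopCoeff 5 1 := by
    have := ((TopCoeff.mk h₀).weaken (n := 5) (by norm_num)).add
      (⟨by simp, by simp⟩ : (X ^ 5 : Polynomial ℝ).TopCoeff 5 1)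
    rwa [sub_add_cancel, zero_add] at this
  by_cases hα : α = 0
  swap
  · exact h.injective_quartic hα hf h₃ h₂ h₁ h₀
  simp only [hα, zero_mul, zero_add] at hf
  by_cases hz : a₃ = 0
  · exact h.injective_of_natDegree_two_le (by simpa [hz] using hf) h₂ h₁ t₀
  by_cases hd : a₃.natDegree = 0
  · obtain ⟨β, rfl⟩ := natDegree_eq_zero.1 hd
    have hβ : β ≠ 0 := by simpa using hz
    simp only [eval_C] at hf
    by_cases hγ : a₂.coeff 2 = 0
    · refine h.injective_cubic hβ hf ?_ h₁ h₀
      by_contra! hcon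
      have h4 : a₂.natDegree = 2 := by omega
      rw [← h4, coeff_natDegree, leadingCoeff_eq_zero] at hγ
      simp [hγ] at h4
    · exact (h.not_cubic_of_const hβ hγ hf (TopCoeff.mk h₂) h₁ t₀ one_ne_zero).elim
  · have hd1 : a₃.natDegree = 1 := by omega
    obtain ⟨r, hr⟩ := surjective_eval_of_odd_natDegree (p := a₃) (by rw [hd1]; decide) 0
    obtain ⟨e, rfl⟩ := exists_eq_mul_of_eval_eq_zero hr
    have he0 : e ≠ 0 := right_ne_zero_of_mul hz
    rw [natDegree_mul (X_sub_C_ne_zero r) he0, natDegree_X_sub_C] at hd1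
    obtain ⟨α, rfl⟩ := natDegree_eq_zero.1 (show e.natDegree = 0 by omega)
    simp only [eval_mul, eval_sub, eval_X, eval_C] at hf
    exact (h.not_cubic_of_linear (α := α) (r := r) (by simpa using he0)
      (fun x y => by rw [hf]; ring) h₂ h₁ t₀ one_ne_zero).elim

end Polynomial

theorem MvPolynomial.exists_eval_pair_eq_sum {p : MvPolynomial (Fin 2) ℝ} {n : ℕ}
    (hp : p.totalDegree ≤ n) : ∃ b : ℕ → Polynomial ℝ, (∀ j, (b j).natDegree ≤ n - j) ∧
      ∀ x y, eval ![x, y] p = ∑ j ∈ Finset.range (n + 1), (b j).eval x * y ^ j := by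
  have hm : ∀ m ∈ p.support, m 0 + m 1 ≤ n := fun m hm => by
    have := (le_totalDegree hm).trans hp
    rwa [Finsupp.sum_fintype _ _ fun _ => rfl, Fin.sum_univ_two] at this
  refine ⟨fun j => ∑ m ∈ p.support with m 1 = j, Polynomial.C (p.coeff m) * Polynomial.X ^ (m 0),
    fun j => ?_, fun x y => ?_⟩
  · refine Polynomial.natDegree_sum_le_of_forall_le _ _ fun m hmj => ?_
    rw [Finset.mem_filter] at hmj
    refine (Polynomial.natDegree_C_mul_X_pow_le _ _).trans ?_
    have := hm m hmj.1
    omega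
  · rw [eval_eq', ← Finset.sum_fiberwise_of_maps_to (g := fun m => m 1)
      (t := Finset.range (n + 1)) fun m hm' => by
        have := hm m hm'
        simp only [Finset.mem_range]
        omega]
    refine Finset.sum_congr rfl fun j _ => ?_
    rw [Polynomial.eval_finsetSum, Finset.sum_mul]
    refine Finset.sum_congr rfl fun m hmj => ?_
    rw [← (Finset.mem_filter.1 hmj).2]
    simp [Fin.prod_univ_two, mul_assoc]

theorem real_jacobian_x_pow_five (f g : MvPolynomial (Fin 2) ℝ)
    (hf : (f - X 0 ^ 5).totalDegree ≤ 4)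
    (hJ : ∀ p : Fin 2 → ℝ, eval p (Jac f g) ≠ 0) :
    Function.Injective (fun p : Fin 2 → ℝ => (eval p f, eval p g)) := by
  obtain ⟨b, hb, hsum⟩ := exists_eval_pair_eq_sum hf
  obtain ⟨α, hα⟩ := Polynomial.natDegree_eq_zero.1 (Nat.le_zero.1 (hb 4))
  have h := (JacPair.of_mvPolynomial hJ).injective_of_natDegree_le (α := α) (a₃ := b 3)
    (a₂ := b 2) (a₁ := b 1) (a₀ := b 0 + Polynomial.X ^ 5) (fun x y => ?_) (hb 3) (hb 2) (hb 1)
    (by simpa using hb 0)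
  · intro p q hpq
    have hvec : ∀ v : Fin 2 → ℝ, ![v 0, v 1] = v := fun v => by
      ext i
      fin_cases i <;> rfl
    have := @h (p 0, p 1) (q 0, q 1) (by simpa only [hvec] using hpq)
    rw [← hvec p, ← hvec q, (Prod.mk.inj this).1, (Prod.mk.inj this).2]
  · have := hsum x y
    simp [Finset.sum_range_succ, ← hα] at this
    simp
    linarith
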